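/- arXiv:0803.3758 — 6 statements merged into one kernel-verified Lean document; each statement's English description precedes it below -/
import Mathlib

section
/- Theorem 1 (delay-independent robust stability via LFR). Suppose there exist real matrices P = Pᵀ > 0 (n×n) and S_i = S_iᵀ > 0 (n×n, i = 1,…,r) such that for every θ ∈ Θ there exist complex matrices G_i ∈ ℂ^{n×d_i} and H_i ∈ ℂ^{d_i×d_i} (i = 0,…,r) for which the complex Hermitian matrix Q(θ;G,H) of size n(r+1)+d is negative definite, where the rows and columns of Q are grouped into a first block of size n, blocks 2,…,r+1 each of size n, and blocks r+2,…,2r+2 of sizes d_0,…,d_r, and the blocks on and above the diagonal are: Q_{1,1} = A_{00}ᵀP + P A_{00} + Σ_{i=1}^r S_i + G_0 C_{p0} + C_{p0}ᵀ G_0^*; Q_{1,1+i} = P A_{0i} for i = 1,…,r; Q_{1,r+2} = P B_{q0}Δ_0(θ) + G_0 D_{pq0}Δ_0(θ) − G_0 + C_{p0}ᵀ H_0^*; Q_{1,r+2+i} = P B_{qi}Δ_i(θ) for i = 1,…,r; Q_{1+i,1+i} = G_i C_{pi} + C_{pi}ᵀ G_i^* − S_i for i = 1,…,r; Q_{1+i,r+2+i}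 = G_i D_{pqi}Δ_i(θ) − G_i + C_{pi}ᵀ H_i^* for i = 1,…,r; Q_{r+2+i,r+2+i} = H_i D_{pqi}Δ_i(θ) + (D_{pqi}Δ_i(θ))ᵀ H_i^* − H_i − H_i^* for i = 0,…,r; all remaining blocks above the diagonal are zero, and the blocks below the diagonal are the conjugate transposes of the corresponding blocks above. Then the unforced delayed system is globally asymptotically stable independent of the delays. -/
open Matrix Filter ComplexOrder

/-- Index type for the `i`-th uncertainty channel (total size `dᵢ = ∑ₖ s_{ki}`). -/
abbrev DIdx {r m : ℕ} (s : Fin (r + 1) → Fin m → ℕ) (i : Fin (r + 1)) : Type :=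
  (k : Fin m) × Fin (s i k)

/-- `Δᵢ(θ) = Diag(θ₁ I_{s₁ᵢ}, …, θ_m I_{s_mᵢ})`. -/
noncomputable def Delta {r m : ℕ} (s : Fin (r + 1) → Fin m → ℕ) (i : Fin (r + 1))
    (θ : Fin m → ℝ) : Matrix (DIdx s i) (DIdx s i) ℝ :=
  Matrix.diagonal fun p => θ p.1

/-- `Aᵢ(θ) = A₀ᵢ + B_{qᵢ} Δᵢ(θ) (I − D_{pqᵢ} Δᵢ(θ))⁻¹ C_{pᵢ}`. -/
noncomputable def Amat {n r m : ℕ} (s : Fin (r + 1) → Fin m → ℕ)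
    (A0 : Fin (r + 1) → Matrix (Fin n) (Fin n) ℝ)
    (Bq : (i : Fin (r + 1)) → Matrix (Fin n) (DIdx s i) ℝ)
    (Cp : (i : Fin (r + 1)) → Matrix (DIdx s i) (Fin n) ℝ)
    (Dpq : (i : Fin (r + 1)) → Matrix (DIdx s i) (DIdx s i) ℝ)
    (i : Fin (r + 1)) (θ : Fin m → ℝ) : Matrix (Fin n) (Fin n) ℝ :=
  A0 i + Bq i * Delta s i θ * (1 - Dpq i * Delta s i θ)⁻¹ * Cp i

/-- Entrywise coercion of a real matrix to a complex matrix. -/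
noncomputable def toC {α β : Type*} (M : Matrix α β ℝ) : Matrix α β ℂ :=
  M.map (Complex.ofReal ·)

/-- The complex Hermitian matrix `Q(θ; G, H)` of Theorem 1: rows/columns are grouped into a
first block of size `n` (index `Sum.inl (0, ·)`), blocks `2, …, r+1` of size `n`
(index `Sum.inl (i, ·)`, `i ≠ 0`), and uncertainty blocks of sizes `d₀, …, d_r`
(index `Sum.inr ⟨i, ·⟩`); blocks below the diagonal are the conjugate transposes of the
corresponding blocks above. -/
noncomputable def Q1 {n r m : ℕ} (s : Fin (r + 1) → Fin m → ℕ)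
    (A0 : Fin (r + 1) → Matrix (Fin n) (Fin n) ℝ)
    (Bq : (i : Fin (r + 1)) → Matrix (Fin n) (DIdx s i) ℝ)
    (Cp : (i : Fin (r + 1)) → Matrix (DIdx s i) (Fin n) ℝ)
    (Dpq : (i : Fin (r + 1)) → Matrix (DIdx s i) (DIdx s i) ℝ)
    (P : Matrix (Fin n) (Fin n) ℝ) (S : Fin r → Matrix (Fin n) (Fin n) ℝ)
    (θ : Fin m → ℝ)
    (G : (i : Fin (r + 1)) → Matrix (Fin n) (DIdx s i) ℂ)
    (H : (i : Fin (r + 1)) → Matrix (DIdx s i) (DIdx s i) ℂ) :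
    Matrix ((Fin (r + 1) × Fin n) ⊕ ((i : Fin (r + 1)) × DIdx s i))
      ((Fin (r + 1) × Fin n) ⊕ ((i : Fin (r + 1)) × DIdx s i)) ℂ :=
  Matrix.of fun p q =>
    match p, q with
    | Sum.inl (i, a), Sum.inl (j, b) =>
      if hi : i = 0 then
        if j = 0 then
          (toC ((A0 0)ᵀ * P + P * A0 0 + ∑ l : Fin r, S l)
            + G 0 * toC (Cp 0) + (toC (Cp 0))ᵀ * (G 0)ᴴ) a b
        else toC (P * A0 j) a b
      else
        if j = 0 then star (toC (P * A0 i) b a)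
        else if i = j then
          (G i * toC (Cp i) + (toC (Cp i))ᵀ * (G i)ᴴ - toC (S (i.pred hi))) a b
        else 0
    | Sum.inl (i, a), Sum.inr ⟨j, b⟩ =>
      if i = 0 then
        if j = 0 then
          (toC (P * Bq j * Delta s j θ) + G j * toC (Dpq j * Delta s j θ) - G j
            + (toC (Cp j))ᵀ * (H j)ᴴ) a b
        else toC (P * Bq j * Delta s j θ) a b
      else if i = j then
        (G j * toC (Dpq j * Delta s j θ) - G j + (toC (Cp j))ᵀ * (H j)ᴴ) a b
      else 0
    | Sum.inr ⟨i, a⟩, Sum.inl (j, b) =>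
      if j = 0 then
        if i = 0 then
          star ((toC (P * Bq i * Delta s i θ) + G i * toC (Dpq i * Delta s i θ) - G i
            + (toC (Cp i))ᵀ * (H i)ᴴ) b a)
        else star (toC (P * Bq i * Delta s i θ) b a)
      else if j = i then
        star ((G i * toC (Dpq i * Delta s i θ) - G i + (toC (Cp i))ᵀ * (H i)ᴴ) b a)
      else 0
    | Sum.inr ⟨i, a⟩, Sum.inr ⟨j, b⟩ =>
      if hij : j = i then
        (H i * toC (Dpq i * Delta s i θ) + (toC (Dpq i * Delta s i θ))ᵀ * (H i)ᴴ
          - H i - (H i)ᴴ) a (hij ▸ b)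
      else 0

open MeasureTheory in
/-- A nonnegative function with bounded derivative and bounded integral tends to zero. -/
theorem tendsto_zero_of_bounded_deriv_of_bounded_integral {g g' : ℝ → ℝ} {B L K : ℝ}
    (hg : Continuous g) (hg0 : ∀ t, 0 ≤ g t)
    (hd : ∀ t > 0, HasDerivAt g (g' t) t) (hB : ∀ t > 0, g t ≤ B) (hL : ∀ t > 0, |g' t| ≤ L)
    (hK : ∀ t ≥ 0, ∫ u in (0 : ℝ)..t, g u ≤ K) : Tendsto g atTop (nhds 0) := by
  have hint : IntegrableOn g (Set.Ioi 0) := by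
    refine integrableOn_Ioi_of_intervalIntegral_norm_bounded K 0
      (fun i : ℝ => (hg.integrableOn_Icc).mono_set Set.Ioc_subset_Icc_self) tendsto_id ?_
    filter_upwards [eventually_ge_atTop 0] with t ht
    simpa [abs_of_nonneg (hg0 _)] using hK t ht
  have hsq : ∀ t ∈ Set.Ioi (0 : ℝ), HasDerivAt (fun t => g t ^ 2) (2 * g t * g' t) t := by
    intro t ht
    simpa using (hd t ht).fun_pow 2
  have hsqi : IntegrableOn (fun t => g t ^ 2) (Set.Ioi 0) := by
    refine Integrable.mono' (hint.const_mul B) (by fun_prop) ?_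
    refine (ae_restrict_iff' measurableSet_Ioi).2 (ae_of_all _ fun t ht => ?_)
    rw [Real.norm_eq_abs, abs_of_nonneg (by positivity), sq]
    exact mul_le_mul_of_nonneg_right (hB t ht) (hg0 t)
  have hdi : IntegrableOn (fun t => 2 * g t * g' t) (Set.Ioi 0) := by
    refine Integrable.mono' (hint.const_mul (2 * L)) ?_ ?_
    · refine (aestronglyMeasurable_deriv (fun t => g t ^ 2) _).congr ?_
      exact (ae_restrict_iff' measurableSet_Ioi).2 (ae_of_all _ fun t ht => (hsq t ht).deriv)
    · refine (ae_restrict_iff' measurableSet_Ioi).2 (ae_of_all _ fun t ht => ?_)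
      rw [Real.norm_eq_abs, abs_mul, abs_mul, abs_two, abs_of_nonneg (hg0 t)]
      have := mul_le_mul_of_nonneg_left (hL t ht) (hg0 t)
      linarith
  have h := tendsto_zero_of_hasDerivAt_of_integrableOn_Ioi hsq hdi hsqi
  simpa [Real.sqrt_sq (hg0 _)] using h.sqrt

theorem HasDerivAt.fun_dotProduct {n : ℕ} {x y : ℝ → Fin n → ℝ} {x' y' : Fin n → ℝ} {t : ℝ}
    (hx : HasDerivAt x x' t) (hy : HasDerivAt y y' t) :
    HasDerivAt (fun u => x u ⬝ᵥ y u) (x' ⬝ᵥ y t + x t ⬝ᵥ y') t := by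
  simp only [dotProduct, ← Finset.sum_add_distrib]
  exact HasDerivAt.fun_sum fun i _ => (hasDerivAt_pi.1 hx i).mul (hasDerivAt_pi.1 hy i)

theorem HasDerivAt.fun_const_mulVec {n : ℕ} {x : ℝ → Fin n → ℝ} {x' : Fin n → ℝ} {t : ℝ}
    (M : Matrix (Fin n) (Fin n) ℝ) (hx : HasDerivAt x x' t) :
    HasDerivAt (fun u => M *ᵥ x u) (M *ᵥ x') t :=
  (LinearMap.toContinuousLinearMap (Matrix.mulVecLin M)).hasFDerivAt.comp_hasDerivAt t hx

/-- Integrated decrease of the Lyapunov–Krasovskii functional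
`V(t) = xᵀ P x + ∑ ∫_{t-hₗ}^t xᵀ Sₗ x`. -/
theorem lyapunov_krasovskii_bound {n r : ℕ} {P : Matrix (Fin n) (Fin n) ℝ} (hPsym : Pᵀ = P)
    {S : Fin r → Matrix (Fin n) (Fin n) ℝ} (hS : ∀ l, (S l).PosDef) {h : Fin r → ℝ}
    (hh : ∀ l, 0 ≤ h l) {x f : ℝ → Fin n → ℝ} (hxc : Continuous x)
    (hx : ∀ t > 0, HasDerivAt x (f t) t) {ε : ℝ}
    (hW : ∀ t > 0, 2 * (x t ⬝ᵥ P *ᵥ f t) +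
      ∑ l, (x t ⬝ᵥ S l *ᵥ x t - x (t - h l) ⬝ᵥ S l *ᵥ x (t - h l)) ≤ -(ε * (x t ⬝ᵥ x t))) :
    ∃ K, ∀ t ≥ 0, x t ⬝ᵥ P *ᵥ x t + ε * ∫ u in (0 : ℝ)..t, x u ⬝ᵥ x u ≤ K := by
  have hgc : Continuous fun u => x u ⬝ᵥ x u := hxc.dotProduct hxc
  have hsc : ∀ l, Continuous fun u => x u ⬝ᵥ S l *ᵥ x u := fun l =>
    hxc.dotProduct (continuous_const.matrix_mulVec hxc)
  have hPc : Continuous fun u => x u ⬝ᵥ P *ᵥ x u :=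
    hxc.dotProduct (continuous_const.matrix_mulVec hxc)
  let J : Fin r → ℝ → ℝ := fun l t => ∫ u in (0 : ℝ)..t, x u ⬝ᵥ S l *ᵥ x u
  have hJ : ∀ l t, HasDerivAt (J l) (x t ⬝ᵥ S l *ᵥ x t) t := fun l t =>
    (hsc l).integral_hasStrictDerivAt 0 t |>.hasDerivAt
  have hJc : ∀ l, Continuous (J l) := fun l =>
    continuous_iff_continuousAt.2 fun t => (hJ l t).continuousAt
  have hI : ∀ t, HasDerivAt (fun t => ∫ u in (0 : ℝ)..t, x u ⬝ᵥ x u) (x t ⬝ᵥ x t) t := fun t =>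
    hgc.integral_hasStrictDerivAt 0 t |>.hasDerivAt
  have hIc : Continuous fun t => ∫ u in (0 : ℝ)..t, x u ⬝ᵥ x u :=
    continuous_iff_continuousAt.2 fun t => (hI t).continuousAt
  let V : ℝ → ℝ := fun t => x t ⬝ᵥ P *ᵥ x t + ∑ l, (J l t - J l (t - h l)) +
    ε * ∫ u in (0 : ℝ)..t, x u ⬝ᵥ x u
  have hVd : ∀ t > 0, HasDerivAt V ((f t ⬝ᵥ P *ᵥ x t + x t ⬝ᵥ P *ᵥ f t) +
      ∑ l, (x t ⬝ᵥ S l *ᵥ x t - x (t - h l) ⬝ᵥ S l *ᵥ x (t - h l)) + ε * (x t ⬝ᵥ x t)) t := by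
    intro t ht
    refine (((hx t ht).fun_dotProduct ((hx t ht).fun_const_mulVec P)).fun_add ?_).fun_add
      ((hI t).const_mul ε)
    exact HasDerivAt.fun_sum fun l _ => (hJ l t).fun_sub ((hJ l (t - h l)).comp_sub_const t (h l))
  have hVc : Continuous V := by
    refine (hPc.add (continuous_finsetSum _ fun l _ => (hJc l).sub ?_)).add
      (continuous_const.mul hIc)
    exact (hJc l).comp (continuous_id.sub continuous_const)
  have hanti : AntitoneOn V (Set.Ici 0) := by
    refine antitoneOn_of_deriv_nonpos (convex_Ici 0) hVc.continuousOn ?_ ?_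
    · rw [interior_Ici]
      exact fun t ht => (hVd t ht).differentiableAt.differentiableWithinAt
    · rw [interior_Ici]
      intro t ht
      rw [(hVd t ht).deriv]
      have hcomm : f t ⬝ᵥ P *ᵥ x t = x t ⬝ᵥ P *ᵥ f t := by
        rw [dotProduct_comm, ← vecMul_transpose, hPsym, ← dotProduct_mulVec]
      have := hW t ht
      rw [hcomm]
      linarith
  refine ⟨V 0, fun t ht => ?_⟩
  have hle : V t ≤ V 0 := hanti (Set.mem_Ici.2 le_rfl) ht ht
  have hpos : 0 ≤ ∑ l, (J l t - J l (t - h l)) := by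
    refine Finset.sum_nonneg fun l _ => ?_
    rw [intervalIntegral.integral_interval_sub_left ((hsc l).intervalIntegrable _ _)
      ((hsc l).intervalIntegrable _ _)]
    refine intervalIntegral.integral_nonneg (by linarith [hh l]) fun u _ => ?_
    simpa using (hS l).posSemidef.dotProduct_mulVec_nonneg (x u)
  have : V t = x t ⬝ᵥ P *ᵥ x t + ∑ l, (J l t - J l (t - h l)) +
    ε * ∫ u in (0 : ℝ)..t, x u ⬝ᵥ x u := rfl
  linarith

/-- A continuous family of positive, degree-two homogeneous functions over a compact parameter set
is uniformly bounded below by a multiple of the squared norm. -/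
theorem exists_pos_mul_sq_norm_le {X E : Type*} [TopologicalSpace X] [NormedAddCommGroup E]
    [NormedSpace ℝ E] [FiniteDimensional ℝ E] {K : Set X} (hK : IsCompact K) {F : X → E → ℝ}
    (hF : ContinuousOn (fun p : X × E => F p.1 p.2) (K ×ˢ Set.univ))
    (hhom : ∀ k ∈ K, ∀ (c : ℝ) (y : E), F k (c • y) = c ^ 2 * F k y)
    (hpos : ∀ k ∈ K, ∀ y ≠ 0, 0 < F k y) :
    ∃ ε > 0, ∀ k ∈ K, ∀ y, ε * ‖y‖ ^ 2 ≤ F k y := by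
  have hC : IsCompact (K ×ˢ Metric.sphere (0 : E) 1) := hK.prod (isCompact_sphere 0 1)
  have hsphere : ∃ ε > 0, ∀ k ∈ K, ∀ y ∈ Metric.sphere (0 : E) 1, ε ≤ F k y := by
    rcases (K ×ˢ Metric.sphere (0 : E) 1).eq_empty_or_nonempty with he | hne
    · refine ⟨1, one_pos, fun k hk y hy => ?_⟩
      exact absurd (Set.mk_mem_prod hk hy) (he ▸ Set.notMem_empty _)
    · obtain ⟨⟨k₀, y₀⟩, ⟨hk₀, hy₀⟩, hmin⟩ := hC.exists_isMinOn hne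
        (hF.mono (Set.prod_mono le_rfl (Set.subset_univ _)))
      refine ⟨F k₀ y₀, hpos _ hk₀ _ ?_, fun k hk y hy => hmin (Set.mk_mem_prod hk hy)⟩
      exact ne_zero_of_mem_unit_sphere ⟨y₀, hy₀⟩
  obtain ⟨ε, hε, hle⟩ := hsphere
  refine ⟨ε, hε, fun k hk y => ?_⟩
  rcases eq_or_ne y 0 with rfl | hy
  · have := hhom k hk 0 0
    simp at this
    simp [this]
  · have hn : ‖y‖ ≠ 0 := norm_ne_zero_iff.2 hy
    have h1 := hle k hk (‖y‖⁻¹ • y) (by simp [norm_smul, hn])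
    have h2 := hhom k hk ‖y‖ (‖y‖⁻¹ • y)
    rw [smul_inv_smul₀ hn] at h2
    rw [h2, mul_comm]
    gcongr

theorem dotProduct_self_le_card_mul_sq_norm {n : ℕ} (y : Fin n → ℝ) :
    y ⬝ᵥ y ≤ n * ‖y‖ ^ 2 := by
  have : ∀ i ∈ Finset.univ, y i * y i ≤ ‖y‖ ^ 2 := fun i _ => by
    rw [← sq, ← sq_abs]
    have := norm_le_pi_norm y i
    rw [Real.norm_eq_abs] at this
    gcongr
  simpa [dotProduct] using Finset.sum_le_card_nsmul _ _ _ this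

/-- Block expansion of a quadratic form over the index type of `Q1`. -/
theorem quadraticForm_block_expand {ι α : Type*} {β : ι → Type*} [Fintype ι] [Fintype α]
    [∀ i, Fintype (β i)] (Q : Matrix ((ι × α) ⊕ ((i : ι) × β i)) ((ι × α) ⊕ ((i : ι) × β i)) ℂ)
    (y : ι → α → ℂ) (p : (i : ι) → β i → ℂ) :
    star (Sum.elim (fun k : ι × α => y k.1 k.2) (fun k : (i : ι) × β i => p k.1 k.2)) ⬝ᵥ
      Q *ᵥ (Sum.elim (fun k : ι × α => y k.1 k.2) (fun k : (i : ι) × β i => p k.1 k.2)) =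
    ∑ i, ∑ j, (star (y i) ⬝ᵥ (Matrix.of fun a b => Q (.inl (i, a)) (.inl (j, b))) *ᵥ y j +
      star (y i) ⬝ᵥ (Matrix.of fun a b => Q (.inl (i, a)) (.inr ⟨j, b⟩)) *ᵥ p j +
      star (p i) ⬝ᵥ (Matrix.of fun a b => Q (.inr ⟨i, a⟩) (.inl (j, b))) *ᵥ y j +
      star (p i) ⬝ᵥ (Matrix.of fun a b => Q (.inr ⟨i, a⟩) (.inr ⟨j, b⟩)) *ᵥ p j) := by
  simp only [dotProduct, mulVec, Fintype.sum_sum_type, Fintype.sum_prod_type, Fintype.sum_sigma,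
    Sum.elim_inl, Sum.elim_inr, Pi.star_apply, Matrix.of_apply, Finset.sum_add_distrib, mul_add]
  have h1 : ∀ i, ∑ a, ∑ j, star (y i a) * ∑ b, Q (.inl (i, a)) (.inl (j, b)) * y j b =
      ∑ j, ∑ a, star (y i a) * ∑ b, Q (.inl (i, a)) (.inl (j, b)) * y j b :=
    fun i => Finset.sum_comm
  have h2 : ∀ i, ∑ a, ∑ j, star (y i a) * ∑ b, Q (.inl (i, a)) (.inr ⟨j, b⟩) * p j b =
      ∑ j, ∑ a, star (y i a) * ∑ b, Q (.inl (i, a)) (.inr ⟨j, b⟩) * p j b :=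
    fun i => Finset.sum_comm
  have h3 : ∀ i, ∑ a, ∑ j, star (p i a) * ∑ b, Q (.inr ⟨i, a⟩) (.inl (j, b)) * y j b =
      ∑ j, ∑ a, star (p i a) * ∑ b, Q (.inr ⟨i, a⟩) (.inl (j, b)) * y j b :=
    fun i => Finset.sum_comm
  have h4 : ∀ i, ∑ a, ∑ j, star (p i a) * ∑ b, Q (.inr ⟨i, a⟩) (.inr ⟨j, b⟩) * p j b =
      ∑ j, ∑ a, star (p i a) * ∑ b, Q (.inr ⟨i, a⟩) (.inr ⟨j, b⟩) * p j b :=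
    fun i => Finset.sum_comm
  simp only [Finset.mul_sum] at h1 h2 h3 h4 ⊢
  simp only [h1, h2, h3, h4]
  ring

theorem toC_transpose {α β : Type*} (M : Matrix α β ℝ) : (toC M)ᵀ = (toC M)ᴴ := by
  ext a b
  simp [toC]

/-- The multiplier terms vanish on vectors satisfying the channel constraint `C y + E p = p`. -/
theorem multiplier_form_eq_zero {α β : Type*} [Fintype α] [Fintype β]
    (G : Matrix α β ℂ) (H : Matrix β β ℂ) (C : Matrix β α ℝ) (E : Matrix β β ℝ)
    {y : α → ℂ} {p : β → ℂ} (h : toC C *ᵥ y + toC E *ᵥ p = p) :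
    star y ⬝ᵥ (G * toC C + (toC C)ᵀ * Gᴴ) *ᵥ y +
      star y ⬝ᵥ (G * toC E - G + (toC C)ᵀ * Hᴴ) *ᵥ p +
      star p ⬝ᵥ (G * toC E - G + (toC C)ᵀ * Hᴴ)ᴴ *ᵥ y +
      star p ⬝ᵥ (H * toC E + (toC E)ᵀ * Hᴴ - H - Hᴴ) *ᵥ p = 0 := by
  have h' : star p = star (toC C *ᵥ y) + star (toC E *ᵥ p) := by rw [← star_add, h]
  have e1 : star y ⬝ᵥ G *ᵥ (toC C *ᵥ y + toC E *ᵥ p) = star y ⬝ᵥ G *ᵥ p := by rw [h]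
  have e2 : star p ⬝ᵥ H *ᵥ (toC C *ᵥ y + toC E *ᵥ p) = star p ⬝ᵥ H *ᵥ p := by rw [h]
  have e3 : star p ⬝ᵥ Gᴴ *ᵥ y = (star (toC C *ᵥ y) + star (toC E *ᵥ p)) ⬝ᵥ Gᴴ *ᵥ y := by rw [← h']
  have e4 : star p ⬝ᵥ Hᴴ *ᵥ p = (star (toC C *ᵥ y) + star (toC E *ᵥ p)) ⬝ᵥ Hᴴ *ᵥ p := by rw [← h']
  simp only [toC_transpose, add_mulVec, sub_mulVec, dotProduct_add, dotProduct_sub, conjTranspose_add,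
    conjTranspose_sub, conjTranspose_mul, conjTranspose_conjTranspose, ← mulVec_mulVec,
    mulVec_add, add_dotProduct, star_mulVec, ← dotProduct_mulVec] at *
  linear_combination e1 + e2 - e3 - e4

/-- The part of the leading blocks of `Q1` that does not involve the multipliers. -/
noncomputable def nominalBlock {n r : ℕ} (A0 : Fin (r + 1) → Matrix (Fin n) (Fin n) ℝ)
    (P : Matrix (Fin n) (Fin n) ℝ) (S : Fin r → Matrix (Fin n) (Fin n) ℝ) (i j : Fin (r + 1)) :
    Matrix (Fin n) (Fin n) ℝ :=
  if hi : i = 0 then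
    if j = 0 then (A0 0)ᵀ * P + P * A0 0 + ∑ l : Fin r, S l else P * A0 j
  else if j = 0 then (P * A0 i)ᵀ else if i = j then -S (i.pred hi) else 0

theorem dotProduct_toC_mulVec {α β : Type*} [Fintype α] [Fintype β] (M : Matrix α β ℝ)
    (y : α → ℝ) (p : β → ℝ) :
    star (fun a => (y a : ℂ)) ⬝ᵥ toC M *ᵥ (fun b => (p b : ℂ)) = ((y ⬝ᵥ M *ᵥ p : ℝ) : ℂ) := by
  simp [dotProduct, mulVec, toC]

theorem toC_mulVec_ofReal {α β : Type*} [Fintype β] (M : Matrix α β ℝ) (p : β → ℝ) :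
    toC M *ᵥ (fun b => (p b : ℂ)) = fun a => ((M *ᵥ p) a : ℂ) := by
  ext
  simp [dotProduct, mulVec, toC]

theorem toC_conjTranspose {α β : Type*} (M : Matrix α β ℝ) : (toC M)ᴴ = toC Mᵀ := by
  ext a b
  simp [toC]

section Blocks

variable {n r m : ℕ} (s : Fin (r + 1) → Fin m → ℕ)
    (A0 : Fin (r + 1) → Matrix (Fin n) (Fin n) ℝ)
    (Bq : (i : Fin (r + 1)) → Matrix (Fin n) (DIdx s i) ℝ)
    (Cp : (i : Fin (r + 1)) → Matrix (DIdx s i) (Fin n) ℝ)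
    (Dpq : (i : Fin (r + 1)) → Matrix (DIdx s i) (DIdx s i) ℝ)
    (P : Matrix (Fin n) (Fin n) ℝ) (S : Fin r → Matrix (Fin n) (Fin n) ℝ)
    (θ : Fin m → ℝ)
    (G : (i : Fin (r + 1)) → Matrix (Fin n) (DIdx s i) ℂ)
    (H : (i : Fin (r + 1)) → Matrix (DIdx s i) (DIdx s i) ℂ)

theorem Q1_block_inl_inl (i j : Fin (r + 1)) :
    (Matrix.of fun a b => Q1 s A0 Bq Cp Dpq P S θ G H (.inl (i, a)) (.inl (j, b))) =
      (if i = j then G i * toC (Cp i) + (toC (Cp i))ᵀ * (G i)ᴴ else 0) +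
        toC (nominalBlock A0 P S i j) := by
  ext a b
  by_cases hi : i = 0
  · subst hi
    by_cases hj : j = 0
    · subst hj
      simp [Q1, nominalBlock, toC]
      ring
    · simp [Q1, nominalBlock, hj, Ne.symm hj]
  · by_cases hj : j = 0
    · subst hj
      simp [Q1, nominalBlock, hi, toC, -Matrix.transpose_mul]
    · by_cases hij : i = j
      · subst hij
        simp [Q1, nominalBlock, hi, toC, sub_eq_add_neg]
      · simp [Q1, nominalBlock, hi, hj, hij, toC]

theorem Q1_block_inl_inr (i j : Fin (r + 1)) :
    (Matrix.of fun a b => Q1 s A0 Bq Cp Dpq P S θ G H (.inl (i, a)) (.inr ⟨j, b⟩)) =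
      (if i = j then G j * toC (Dpq j * Delta s j θ) - G j + (toC (Cp j))ᵀ * (H j)ᴴ else 0) +
        (if i = 0 then toC (P * Bq j * Delta s j θ) else 0) := by
  ext a b
  by_cases hi : i = 0
  · subst hi
    by_cases hj : j = 0
    · subst hj
      simp [Q1]
      ring
    · simp [Q1, hj, Ne.symm hj]
  · by_cases hij : i = j
    · subst hij
      simp [Q1, hi]
    · simp [Q1, hi, hij]

theorem Q1_block_inr_inl (i j : Fin (r + 1)) :
    (Matrix.of fun a b => Q1 s A0 Bq Cp Dpq P S θ G H (.inr ⟨i, a⟩) (.inl (j, b))) =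
      (Matrix.of fun a b => Q1 s A0 Bq Cp Dpq P S θ G H (.inl (j, a)) (.inr ⟨i, b⟩))ᴴ := by
  ext a b
  simp only [Q1, Matrix.of_apply, conjTranspose_apply]
  split_ifs <;> simp

theorem Q1_block_inr_inr_self (i : Fin (r + 1)) :
    (Matrix.of fun a b => Q1 s A0 Bq Cp Dpq P S θ G H (.inr ⟨i, a⟩) (.inr ⟨i, b⟩)) =
      H i * toC (Dpq i * Delta s i θ) + (toC (Dpq i * Delta s i θ))ᵀ * (H i)ᴴ - H i - (H i)ᴴ := by
  ext a b
  simp [Q1]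

theorem Q1_block_inr_inr_of_ne {i j : Fin (r + 1)} (h : j ≠ i) :
    (Matrix.of fun a b => Q1 s A0 Bq Cp Dpq P S θ G H (.inr ⟨i, a⟩) (.inr ⟨j, b⟩)) = 0 := by
  ext a b
  simp [Q1, h]

/-- On vectors satisfying all channel constraints, the form of `Q1` loses its multipliers. -/
theorem Q1_form_eq {y : Fin (r + 1) → Fin n → ℝ} {p : (i : Fin (r + 1)) → DIdx s i → ℝ}
    (h : ∀ i, Cp i *ᵥ y i + (Dpq i * Delta s i θ) *ᵥ p i = p i) :
    star (Sum.elim (fun k : Fin (r + 1) × Fin n => (y k.1 k.2 : ℂ))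
        (fun k : (i : Fin (r + 1)) × DIdx s i => (p k.1 k.2 : ℂ))) ⬝ᵥ
      Q1 s A0 Bq Cp Dpq P S θ G H *ᵥ (Sum.elim (fun k : Fin (r + 1) × Fin n => (y k.1 k.2 : ℂ))
        (fun k : (i : Fin (r + 1)) × DIdx s i => (p k.1 k.2 : ℂ))) =
    ((∑ i, ∑ j, y i ⬝ᵥ nominalBlock A0 P S i j *ᵥ y j +
      ∑ i, 2 * (y 0 ⬝ᵥ (P * Bq i * Delta s i θ) *ᵥ p i) : ℝ) : ℂ) := by
  refine (quadraticForm_block_expand _ (fun i a => (y i a : ℂ))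
    (fun i a => (p i a : ℂ))).trans ?_
  have hz := fun i => multiplier_form_eq_zero (G i) (H i) (Cp i) (Dpq i * Delta s i θ)
    (y := fun a => (y i a : ℂ)) (p := fun a => (p i a : ℂ)) (by
      rw [toC_mulVec_ofReal, toC_mulVec_ofReal]
      ext a
      have := congrFun (h i) a
      simp only [Pi.add_apply] at this ⊢
      exact_mod_cast this)
  have hz := Finset.sum_eq_zero fun i (_ : i ∈ Finset.univ) => hz i
  have hpp : ∀ i, ∑ j, star (fun a => (p i a : ℂ)) ⬝ᵥ
      (Matrix.of fun a b => Q1 s A0 Bq Cp Dpq P S θ G H (.inr ⟨i, a⟩) (.inr ⟨j, b⟩)) *ᵥ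
        (fun a => (p j a : ℂ)) = star (fun a => (p i a : ℂ)) ⬝ᵥ
      (H i * toC (Dpq i * Delta s i θ) + (toC (Dpq i * Delta s i θ))ᵀ * (H i)ᴴ - H i - (H i)ᴴ) *ᵥ
        (fun a => (p i a : ℂ)) := by
    intro i
    rw [Fintype.sum_eq_single i, Q1_block_inr_inr_self]
    intro j hj
    rw [Q1_block_inr_inr_of_ne _ _ _ _ _ _ _ _ _ _ hj]
    simp
  simp only [Finset.sum_add_distrib] at hz ⊢
  simp only [hpp, Q1_block_inr_inl, Q1_block_inl_inl, Q1_block_inl_inr, add_mulVec,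
    conjTranspose_add, dotProduct_add, Finset.sum_add_distrib, dotProduct_toC_mulVec]
  have hsymm : ∀ i, p i ⬝ᵥ (P * Bq i * Delta s i θ)ᵀ *ᵥ y 0 =
      y 0 ⬝ᵥ (P * Bq i * Delta s i θ) *ᵥ p i := fun i => by
    rw [mulVec_transpose, dotProduct_comm, dotProduct_mulVec]
  have i1 : ∀ (c : Prop) [Decidable c] {α β : Type} [Fintype α] [Fintype β] (M : Matrix α β ℂ)
      (u : α → ℂ) (w : β → ℂ), u ⬝ᵥ (if c then M else 0) *ᵥ w = if c then u ⬝ᵥ M *ᵥ w else 0 := by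
    intros
    split_ifs <;> simp
  have i2 : ∀ (c : Prop) [Decidable c] {α β : Type} (M : Matrix α β ℂ),
      (if c then M else 0)ᴴ = if c then Mᴴ else 0 := by
    intros
    split_ifs <;> simp
  simp only [i1, i2, Finset.sum_ite_eq, Finset.sum_ite_eq', Finset.mem_univ, if_true,
    toC_conjTranspose, dotProduct_toC_mulVec] at hz ⊢
  rw [Finset.sum_comm (f := fun i j => if i = 0 then _ else _)]
  simp only [Finset.sum_ite_eq', Finset.mem_univ, if_true, hsymm]
  push_cast
  rw [← Finset.mul_sum]
  linear_combination hz

end Blocks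

theorem sum_nominalBlock {n r : ℕ} (A0 : Fin (r + 1) → Matrix (Fin n) (Fin n) ℝ)
    {P : Matrix (Fin n) (Fin n) ℝ} (hPsym : Pᵀ = P) (S : Fin r → Matrix (Fin n) (Fin n) ℝ)
    (y : Fin (r + 1) → Fin n → ℝ) :
    ∑ i, ∑ j, y i ⬝ᵥ nominalBlock A0 P S i j *ᵥ y j =
      2 * ∑ i, y 0 ⬝ᵥ P *ᵥ A0 i *ᵥ y i +
        ∑ l : Fin r, (y 0 ⬝ᵥ S l *ᵥ y 0 - y l.succ ⬝ᵥ S l *ᵥ y l.succ) := by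
  have hT : ∀ i, y i ⬝ᵥ (P * A0 i)ᵀ *ᵥ y 0 = y 0 ⬝ᵥ P *ᵥ A0 i *ᵥ y i := fun i => by
    rw [mulVec_transpose, dotProduct_comm, ← dotProduct_mulVec, mulVec_mulVec]
  have h0 : y 0 ⬝ᵥ nominalBlock A0 P S 0 0 *ᵥ y 0 =
      2 * (y 0 ⬝ᵥ P *ᵥ A0 0 *ᵥ y 0) + ∑ l : Fin r, y 0 ⬝ᵥ S l *ᵥ y 0 := by
    have := hT 0
    rw [transpose_mul, hPsym] at this
    simp only [nominalBlock, dif_pos, if_true, add_mulVec, dotProduct_add, this, sum_mulVec,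
      dotProduct_sum]
    rw [mulVec_mulVec]
    ring
  have h1 : ∀ l : Fin r, nominalBlock A0 P S 0 l.succ = P * A0 l.succ := fun l => by
    simp [nominalBlock]
  have h2 : ∀ l : Fin r, nominalBlock A0 P S l.succ 0 = (P * A0 l.succ)ᵀ := fun l => by
    simp [nominalBlock]
  have h3 : ∀ l : Fin r, ∑ k : Fin r, y l.succ ⬝ᵥ nominalBlock A0 P S l.succ k.succ *ᵥ y k.succ =
      -(y l.succ ⬝ᵥ S l *ᵥ y l.succ) := fun l => by
    rw [Fintype.sum_eq_single l]
    · simp [nominalBlock, neg_mulVec]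
    · intro k hk
      simp [nominalBlock, hk.symm]
  simp only [Fin.sum_univ_succ (n := r), h0, h1, h2, h3, hT, ← mulVec_mulVec,
    Finset.sum_add_distrib, Finset.sum_sub_distrib, Finset.sum_neg_distrib]
  ring

section Stability

variable {n r m : ℕ} {s : Fin (r + 1) → Fin m → ℕ}
    {A0 : Fin (r + 1) → Matrix (Fin n) (Fin n) ℝ}
    {Bq : (i : Fin (r + 1)) → Matrix (Fin n) (DIdx s i) ℝ}
    {Cp : (i : Fin (r + 1)) → Matrix (DIdx s i) (Fin n) ℝ}
    {Dpq : (i : Fin (r + 1)) → Matrix (DIdx s i) (DIdx s i) ℝ}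
    {P : Matrix (Fin n) (Fin n) ℝ} {S : Fin r → Matrix (Fin n) (Fin n) ℝ}

theorem lyapunov_form_neg {θ : Fin m → ℝ} (hwell : ∀ i, (1 - Dpq i * Delta s i θ).det ≠ 0)
    (hPsym : Pᵀ = P) {G : (i : Fin (r + 1)) → Matrix (Fin n) (DIdx s i) ℂ}
    {H : (i : Fin (r + 1)) → Matrix (DIdx s i) (DIdx s i) ℂ}
    (hQ : (-(Q1 s A0 Bq Cp Dpq P S θ G H)).PosDef) {y : Fin (r + 1) → Fin n → ℝ} (hy : y ≠ 0) :
    2 * (y 0 ⬝ᵥ P *ᵥ ∑ i, Amat s A0 Bq Cp Dpq i θ *ᵥ y i) +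
      ∑ l : Fin r, (y 0 ⬝ᵥ S l *ᵥ y 0 - y l.succ ⬝ᵥ S l *ᵥ y l.succ) < 0 := by
  let p : (i : Fin (r + 1)) → DIdx s i → ℝ := fun i =>
    (1 - Dpq i * Delta s i θ)⁻¹ *ᵥ Cp i *ᵥ y i
  have hp : ∀ i, Cp i *ᵥ y i + (Dpq i * Delta s i θ) *ᵥ p i = p i := by
    intro i
    have h : (1 - Dpq i * Delta s i θ) *ᵥ p i = Cp i *ᵥ y i := by
      rw [mulVec_mulVec, mul_nonsing_inv _ (isUnit_iff_ne_zero.2 (hwell i)), one_mulVec]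
    rw [sub_mulVec, one_mulVec] at h
    rw [← h, sub_add_cancel]
  have hform := Q1_form_eq s A0 Bq Cp Dpq P S θ G H hp
  have hpos := hQ.dotProduct_mulVec_pos (x := Sum.elim
      (fun k : Fin (r + 1) × Fin n => (y k.1 k.2 : ℂ))
      (fun k : (i : Fin (r + 1)) × DIdx s i => (p k.1 k.2 : ℂ))) (by
    contrapose! hy
    ext i a
    simpa using congrFun hy (.inl (i, a)))
  rw [neg_mulVec, dotProduct_neg, hform, sum_nominalBlock A0 hPsym] at hpos
  have hpos := Complex.zero_lt_real.1 (by rw [Complex.ofReal_neg]; exact hpos)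
  have hA : y 0 ⬝ᵥ P *ᵥ ∑ i, Amat s A0 Bq Cp Dpq i θ *ᵥ y i =
      ∑ i, y 0 ⬝ᵥ P *ᵥ A0 i *ᵥ y i + ∑ i, y 0 ⬝ᵥ (P * Bq i * Delta s i θ) *ᵥ p i := by
    rw [mulVec_sum, dotProduct_sum, ← Finset.sum_add_distrib]
    refine Finset.sum_congr rfl fun i _ => ?_
    simp only [Amat, add_mulVec, mulVec_add, dotProduct_add, ← mulVec_mulVec, p]
  rw [← Finset.mul_sum] at hpos
  rw [hA]
  linarith

theorem continuousOn_Amat {Θ : Set (Fin m → ℝ)}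
    (hwell : ∀ θ ∈ Θ, ∀ i, (1 - Dpq i * Delta s i θ).det ≠ 0) (i : Fin (r + 1)) :
    ContinuousOn (fun θ => Amat s A0 Bq Cp Dpq i θ) Θ := by
  have hD : Continuous fun θ => Delta s i θ :=
    Continuous.matrix_diagonal (continuous_pi fun k => continuous_apply _)
  have hM : Continuous fun θ => 1 - Dpq i * Delta s i θ :=
    continuous_const.sub (continuous_const.matrix_mul hD)
  have hinv : ContinuousOn (fun θ => (1 - Dpq i * Delta s i θ)⁻¹) Θ := by
    simp only [Matrix.inv_def, Ring.inverse_eq_inv']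
    exact (hM.matrix_det.continuousOn.inv₀ fun θ hθ => hwell θ hθ i).smul
      hM.matrix_adjugate.continuousOn
  rw [continuousOn_iff_continuous_domRestrict] at hinv ⊢
  exact continuous_const.add (((continuous_const.matrix_mul
    (hD.comp continuous_subtype_val)).matrix_mul hinv).matrix_mul continuous_const)

theorem continuousOn_vectorField {Θ : Set (Fin m → ℝ)}
    (hwell : ∀ θ ∈ Θ, ∀ i, (1 - Dpq i * Delta s i θ).det ≠ 0) :
    ContinuousOn (fun q : (Fin m → ℝ) × (Fin (r + 1) → Fin n → ℝ) =>
      ∑ i, Amat s A0 Bq Cp Dpq i q.1 *ᵥ q.2 i) (Θ ×ˢ Set.univ) := by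
  refine continuousOn_finsetSum _ fun i _ => ?_
  have h := (continuousOn_Amat (A0 := A0) (Bq := Bq) (Cp := Cp) hwell i).comp
    (continuous_fst (X := Fin m → ℝ) (Y := Fin (r + 1) → Fin n → ℝ)).continuousOn
    (fun q (hq : q ∈ Θ ×ˢ Set.univ) => hq.1)
  rw [continuousOn_iff_continuous_domRestrict] at h ⊢
  exact h.matrix_mulVec
    (((continuous_apply i).comp continuous_snd).comp continuous_subtype_val)

/-- The Lyapunov–Krasovskii derivative is uniformly negative over a compact parameter set. -/
theorem exists_lyapunov_form_le {Θ : Set (Fin m → ℝ)} (hΘ : IsCompact Θ)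
    (hwell : ∀ θ ∈ Θ, ∀ i, (1 - Dpq i * Delta s i θ).det ≠ 0) (hPsym : Pᵀ = P)
    (hQ : ∀ θ ∈ Θ,
      ∃ G : (i : Fin (r + 1)) → Matrix (Fin n) (DIdx s i) ℂ,
      ∃ H : (i : Fin (r + 1)) → Matrix (DIdx s i) (DIdx s i) ℂ,
        (-(Q1 s A0 Bq Cp Dpq P S θ G H)).PosDef) :
    ∃ ε > 0, ∀ θ ∈ Θ, ∀ y : Fin (r + 1) → Fin n → ℝ,
      2 * (y 0 ⬝ᵥ P *ᵥ ∑ i, Amat s A0 Bq Cp Dpq i θ *ᵥ y i) +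
        ∑ l : Fin r, (y 0 ⬝ᵥ S l *ᵥ y 0 - y l.succ ⬝ᵥ S l *ᵥ y l.succ) ≤ -(ε * ‖y‖ ^ 2) := by
  let F : (Fin m → ℝ) → (Fin (r + 1) → Fin n → ℝ) → ℝ := fun θ y =>
    -(2 * (y 0 ⬝ᵥ P *ᵥ ∑ i, Amat s A0 Bq Cp Dpq i θ *ᵥ y i) +
      ∑ l : Fin r, (y 0 ⬝ᵥ S l *ᵥ y 0 - y l.succ ⬝ᵥ S l *ᵥ y l.succ))
  suffices h : ∃ ε > 0, ∀ θ ∈ Θ, ∀ y, ε * ‖y‖ ^ 2 ≤ F θ y by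
    obtain ⟨ε, hε, h⟩ := h
    exact ⟨ε, hε, fun θ hθ y => le_neg.1 (h θ hθ y)⟩
  refine exists_pos_mul_sq_norm_le hΘ ?_ ?_ ?_
  · have hv := continuousOn_vectorField (A0 := A0) (Bq := Bq) (Cp := Cp) hwell
    have hy : ∀ i, Continuous fun q : (Fin m → ℝ) × (Fin (r + 1) → Fin n → ℝ) => q.2 i :=
      fun i => (continuous_apply i).comp continuous_snd
    have hS : ∀ i (M : Matrix (Fin n) (Fin n) ℝ), Continuous
        fun q : (Fin m → ℝ) × (Fin (r + 1) → Fin n → ℝ) => q.2 i ⬝ᵥ M *ᵥ q.2 i := fun i M =>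
      (hy i).dotProduct (continuous_const.matrix_mulVec (hy i))
    refine ((continuousOn_const.mul ?_).add ?_).neg
    · rw [continuousOn_iff_continuous_domRestrict] at hv ⊢
      exact ((hy 0).comp continuous_subtype_val).dotProduct (continuous_const.matrix_mulVec hv)
    · exact (continuous_finsetSum _ fun l _ => (hS 0 _).sub (hS l.succ _)).continuousOn
  · intro θ _ c y
    simp only [F, Pi.smul_apply, mulVec_smul, ← Finset.smul_sum, smul_dotProduct, dotProduct_smul,
      smul_eq_mul, ← mul_sub, ← Finset.mul_sum]
    ring
  · intro θ hθ y hy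
    obtain ⟨G, H, hGH⟩ := hQ θ hθ
    exact neg_pos.2 (lyapunov_form_neg (hwell θ hθ) hPsym hGH hy)

end Stability

/-- **Theorem 1 (delay-independent robust stability via LFR).**
If there exist `P = Pᵀ > 0` and `Sᵢ = Sᵢᵀ > 0` such that for every `θ ∈ Θ` there are complex
multipliers `Gᵢ, Hᵢ` making the Hermitian matrix `Q(θ; G, H)` negative definite, then the
unforced delayed system is globally asymptotically stable independent of the delays. -/
theorem theorem1_delay_independent_robust_stability
    (n r m : ℕ) (hn : 1 ≤ n) (hr : 1 ≤ r) (hm : 1 ≤ m)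
    (v : ℕ) (hv : 1 ≤ v) (θvert : Fin v → Fin m → ℝ)
    (Θ : Set (Fin m → ℝ)) (hΘ : Θ = convexHull ℝ (Set.range θvert))
    (hΘ0 : (0 : Fin m → ℝ) ∈ Θ)
    (s : Fin (r + 1) → Fin m → ℕ)
    (A0 : Fin (r + 1) → Matrix (Fin n) (Fin n) ℝ)
    (Bq : (i : Fin (r + 1)) → Matrix (Fin n) (DIdx s i) ℝ)
    (Cp : (i : Fin (r + 1)) → Matrix (DIdx s i) (Fin n) ℝ)
    (Dpq : (i : Fin (r + 1)) → Matrix (DIdx s i) (DIdx s i) ℝ)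
    (hwell : ∀ θ ∈ Θ, ∀ i, (1 - Dpq i * Delta s i θ).det ≠ 0)
    (P : Matrix (Fin n) (Fin n) ℝ) (hPsym : Pᵀ = P) (hP : P.PosDef)
    (S : Fin r → Matrix (Fin n) (Fin n) ℝ)
    (hSsym : ∀ i, (S i)ᵀ = S i) (hS : ∀ i, (S i).PosDef)
    (hQ : ∀ θ ∈ Θ,
      ∃ G : (i : Fin (r + 1)) → Matrix (Fin n) (DIdx s i) ℂ,
      ∃ H : (i : Fin (r + 1)) → Matrix (DIdx s i) (DIdx s i) ℂ,
        (-(Q1 s A0 Bq Cp Dpq P S θ G H)).PosDef) :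
    ∀ hdel : Fin (r + 1) → ℝ, hdel 0 = 0 → (∀ i, 0 ≤ hdel i) →
      ∀ θ : ℝ → Fin m → ℝ, Continuous θ → (∀ t ≥ (0 : ℝ), θ t ∈ Θ) →
        ∀ x : ℝ → Fin n → ℝ,
          ContinuousOn x (Set.Ici (-(⨆ i, hdel i))) →
          (∀ t > (0 : ℝ), HasDerivAt x
            (∑ i, (Amat s A0 Bq Cp Dpq i (θ t)).mulVec (x (t - hdel i))) t) →
          (∃ C : ℝ, ∀ t ≥ -(⨆ i, hdel i), ‖x t‖ ≤ C) ∧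
            Tendsto x atTop (nhds 0) := by
  intro hdel hdel0 hdelnn θ hθc hθ x hxc hx
  have hle : ∀ i, hdel i ≤ ⨆ i, hdel i := le_ciSup (Set.finite_range hdel).bddAbove
  set h : ℝ := ⨆ i, hdel i
  have hh : 0 ≤ h := hdel0 ▸ hle 0
  have hΘc : IsCompact Θ := hΘ ▸ (Set.finite_range θvert).isCompact_convexHull ℝ
  -- extend the initial segment constantly to a globally continuous function
  let z : ℝ → Fin n → ℝ := fun t => x (max t (-h))
  have hzx : ∀ t ≥ -h, z t = x t := fun t ht => by simp only [z, max_eq_left ht]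
  have hzc : Continuous z := hxc.comp_continuous (by fun_prop) fun t =>
    Set.mem_Ici.2 (le_max_right _ _)
  let Y : ℝ → Fin (r + 1) → Fin n → ℝ := fun t i => z (t - hdel i)
  have hY0 : ∀ t, Y t 0 = z t := fun t => by simp only [Y, hdel0, sub_zero]
  let f : ℝ → Fin n → ℝ := fun t => ∑ i, Amat s A0 Bq Cp Dpq i (θ t) *ᵥ Y t i
  have hz : ∀ t > 0, HasDerivAt z (f t) t := by
    intro t ht
    have hf : f t = ∑ i, (Amat s A0 Bq Cp Dpq i (θ t)).mulVec (x (t - hdel i)) :=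
      Finset.sum_congr rfl fun i _ => by
        simp only [Y]
        rw [hzx _ (by linarith [hle i])]
    rw [hf]
    refine (hx t ht).congr_of_eventuallyEq ?_
    filter_upwards [lt_mem_nhds ht] with u hu
    exact hzx u (by linarith)
  obtain ⟨ε, hε, hneg⟩ := exists_lyapunov_form_le hΘc hwell hPsym hQ
  obtain ⟨lam, hlam, hPlow⟩ := exists_pos_mul_sq_norm_le (isCompact_singleton (x := ()))
    (F := fun _ (y : Fin n → ℝ) => y ⬝ᵥ P *ᵥ y)
    (continuous_snd.dotProduct (continuous_const.matrix_mulVec continuous_snd)).continuousOn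
    (fun _ _ c y => by
      simp only [mulVec_smul, smul_dotProduct, dotProduct_smul, smul_eq_mul]
      ring)
    (fun _ _ y hy => by simpa using hP.dotProduct_mulVec_pos hy)
  obtain ⟨κ, hκ, hdotlow⟩ := exists_pos_mul_sq_norm_le (isCompact_singleton (x := ()))
    (F := fun _ (y : Fin n → ℝ) => y ⬝ᵥ y)
    (continuous_snd.dotProduct continuous_snd).continuousOn
    (fun _ _ c y => by
      simp only [smul_dotProduct, dotProduct_smul, smul_eq_mul]
      ring)
    (fun _ _ y hy => by simpa using Matrix.dotProduct_star_self_pos_iff.2 hy)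
  have hn0 : (0 : ℝ) < n := by exact_mod_cast hn
  have hg0 : ∀ t, 0 ≤ z t ⬝ᵥ z t := fun t =>
    (by positivity : 0 ≤ κ * ‖z t‖ ^ 2).trans (hdotlow () rfl (z t))
  obtain ⟨K, hK⟩ := lyapunov_krasovskii_bound (ε := ε / n) hPsym hS
    (h := fun l => hdel l.succ) (fun l => hdelnn _) hzc hz (fun t ht => by
      have h1 := hneg (θ t) (hθ t ht.le) (Y t)
      rw [hY0] at h1
      refine h1.trans (neg_le_neg ?_)
      have h2 : ‖z t‖ ≤ ‖Y t‖ := hY0 t ▸ norm_le_pi_norm (Y t) 0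
      calc ε / n * (z t ⬝ᵥ z t) ≤ ε / n * (n * ‖z t‖ ^ 2) := by
            gcongr
            exact dotProduct_self_le_card_mul_sq_norm _
        _ = ε * ‖z t‖ ^ 2 := by field_simp
        _ ≤ ε * ‖Y t‖ ^ 2 := by gcongr)
  have hint0 : ∀ t ≥ 0, 0 ≤ ∫ u in (0 : ℝ)..t, z u ⬝ᵥ z u := fun t ht =>
    intervalIntegral.integral_nonneg ht fun u _ => hg0 u
  have hP0 : ∀ y : Fin n → ℝ, 0 ≤ y ⬝ᵥ P *ᵥ y := fun y =>
    (by positivity : 0 ≤ lam * ‖y‖ ^ 2).trans (hPlow () rfl y)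
  -- boundedness
  obtain ⟨B, hB⟩ : ∃ B, ∀ t, ‖z t‖ ≤ B := by
    obtain ⟨B₁, hB₁⟩ := isCompact_Icc.exists_bound_of_continuousOn
      (s := Set.Icc (-h) 0) hzc.continuousOn
    refine ⟨max B₁ √(K / lam), fun t => ?_⟩
    rcases le_total t 0 with ht | ht
    · refine le_max_of_le_left ?_
      have : z t = z (max t (-h)) := by simp only [z, max_assoc, max_self]
      rw [this]
      exact hB₁ _ ⟨le_max_right _ _, max_le ht (by linarith)⟩
    · refine le_max_of_le_right (Real.le_sqrt_of_sq_le ?_)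
      rw [le_div_iff₀ hlam]
      have h1 := hK t ht
      have h2 : 0 ≤ ε / n * ∫ u in (0 : ℝ)..t, z u ⬝ᵥ z u := mul_nonneg (by positivity) (hint0 t ht)
      linarith [hPlow () rfl (z t)]
  refine ⟨⟨B, fun t ht => hzx t ht ▸ hB t⟩, ?_⟩
  obtain ⟨L, hL⟩ := (hΘc.prod (isCompact_closedBall
    (0 : Fin (r + 1) → Fin n → ℝ) B)).exists_bound_of_continuousOn
    (f := fun q => 2 * (q.2 0 ⬝ᵥ ∑ i, Amat s A0 Bq Cp Dpq i q.1 *ᵥ q.2 i)) (by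
      have hv := (continuousOn_vectorField (A0 := A0) (Bq := Bq) (Cp := Cp) hwell).mono
        (Set.prod_mono le_rfl (Set.subset_univ
          (Metric.closedBall (0 : Fin (r + 1) → Fin n → ℝ) B)))
      rw [continuousOn_iff_continuous_domRestrict] at hv ⊢
      exact continuous_const.mul ((((continuous_apply 0).comp continuous_snd).comp
        continuous_subtype_val).dotProduct hv))
  have hB0 : 0 ≤ B := (norm_nonneg _).trans (hB 0)
  have hg : Tendsto (fun t => z t ⬝ᵥ z t) atTop (nhds 0) := by
    refine tendsto_zero_of_bounded_deriv_of_bounded_integral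
      (g' := fun t => 2 * (z t ⬝ᵥ f t)) (B := n * B ^ 2) (L := L) (K := K / (ε / n))
      (hzc.dotProduct hzc) hg0 (fun t ht => ?_) (fun t _ => ?_) (fun t ht => ?_) (fun t ht => ?_)
    · convert (hz t ht).fun_dotProduct (hz t ht) using 1
      rw [dotProduct_comm (f t)]
      ring
    · refine (dotProduct_self_le_card_mul_sq_norm _).trans ?_
      have := hB t
      gcongr
    · have := hL (θ t, Y t) ⟨hθ t ht.le, by
        simpa using (pi_norm_le_iff_of_nonneg hB0).2 fun i => hB (t - hdel i)⟩
      rwa [Real.norm_eq_abs, show (θ t, Y t).2 0 = z t from hY0 t] at this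
    · rw [le_div_iff₀ (by positivity)]
      linarith [hK t ht, hP0 (z t)]
  have hzt : Tendsto z atTop (nhds 0) := by
    rw [tendsto_zero_iff_norm_tendsto_zero]
    refine squeeze_zero (fun t => norm_nonneg _) (fun t => ?_)
      (by simpa using (hg.div_const κ).sqrt)
    refine Real.le_sqrt_of_sq_le ?_
    rw [le_div_iff₀ hκ]
    linarith [hdotlow () rfl (z t)]
  refine hzt.congr' ?_
  filter_upwards [eventually_ge_atTop (-h)] with t ht
  exact hzx t ht
end

section
/- Corollary 2, stability part (nominal, uncertainty-free system). Suppose there exist real matrices P = Pᵀ > 0 and S_i = S_iᵀ > 0 (i = 1,…,r) such that Q_0^{(2)} < 0 (negative definite). Then for every choice of delays h_i ≥ 0 (i = 1,…,r; h_0 = 0), every solution x of the nominal delayed system is bounded and satisfies x(t) → 0 as t → ∞. -/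
open Matrix Filter

/-- The real symmetric `n(r+1) × n(r+1)` block matrix `Q₀⁽²⁾` of Corollary 2:
`(1,1)`-block `A₀₀ᵀP + PA₀₀ + ∑ᵢ Sᵢ`, `(1,i+1)`-blocks `P A₀ᵢ`, `(i+1,i+1)`-blocks `−Sᵢ`,
all other blocks above the diagonal zero, blocks below the diagonal transposes of those above. -/
noncomputable def Q02 {n r : ℕ} (A0 : Fin (r + 1) → Matrix (Fin n) (Fin n) ℝ)
    (P : Matrix (Fin n) (Fin n) ℝ) (S : Fin r → Matrix (Fin n) (Fin n) ℝ) :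
    Matrix (Fin (r + 1) × Fin n) (Fin (r + 1) × Fin n) ℝ :=
  Matrix.of fun p q =>
    if hp : p.1 = 0 then
      if q.1 = 0 then ((A0 0)ᵀ * P + P * A0 0 + ∑ i : Fin r, S i) p.2 q.2
      else (P * A0 q.1) p.2 q.2
    else
      if q.1 = 0 then (P * A0 p.1)ᵀ p.2 q.2
      else if p.1 = q.1 then (-(S (p.1.pred hp))) p.2 q.2
      else 0

/-- A positive definite quadratic form dominates a positive multiple of the squared norm. -/
lemma Matrix.PosDef.exists_pos_mul_sq_norm_le {ι : Type*} [Fintype ι] {M : Matrix ι ι ℝ}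
    (hM : M.PosDef) : ∃ c > 0, ∀ v : ι → ℝ, c * ‖v‖ ^ 2 ≤ v ⬝ᵥ M *ᵥ v := by
  rcases isEmpty_or_nonempty ι with hι | hι
  · exact ⟨1, one_pos, fun v => by simp [Subsingleton.elim v 0]⟩
  have hcont : Continuous fun v : ι → ℝ => v ⬝ᵥ M *ᵥ v := by fun_prop
  have hne : (Metric.sphere (0 : ι → ℝ) 1).Nonempty :=
    NormedSpace.sphere_nonempty.mpr zero_le_one
  obtain ⟨w, hw, hmin⟩ := (isCompact_sphere (0 : ι → ℝ) 1).exists_isMinOn hne hcont.continuousOn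
  have hw0 : w ≠ 0 := by
    rintro rfl
    simp at hw
  refine ⟨w ⬝ᵥ M *ᵥ w, by simpa using hM.dotProduct_mulVec_pos hw0, fun v => ?_⟩
  by_cases hv : v = 0
  · simp [hv]
  have hv' : ‖v‖ ≠ 0 := norm_ne_zero_iff.mpr hv
  have hunit : ‖v‖⁻¹ • v ∈ Metric.sphere (0 : ι → ℝ) 1 := by
    simp [norm_smul, hv']
  have h : w ⬝ᵥ M *ᵥ w ≤ (‖v‖⁻¹ • v) ⬝ᵥ M *ᵥ (‖v‖⁻¹ • v) := hmin hunit
  rw [mulVec_smul, dotProduct_smul, smul_dotProduct, smul_eq_mul, smul_eq_mul] at h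
  calc (w ⬝ᵥ M *ᵥ w) * ‖v‖ ^ 2
      ≤ (‖v‖⁻¹ * (‖v‖⁻¹ * (v ⬝ᵥ M *ᵥ v))) * ‖v‖ ^ 2 := by gcongr
    _ = v ⬝ᵥ M *ᵥ v := by field_simp

/-- A quadratic form on a product index is the sum of the forms of its blocks. -/
lemma dotProduct_mulVec_prod {ι κ : Type*} [Fintype ι] [Fintype κ]
    (M : Matrix (ι × κ) (ι × κ) ℝ) (u : ι → κ → ℝ) :
    (fun p : ι × κ => u p.1 p.2) ⬝ᵥ M *ᵥ (fun p : ι × κ => u p.1 p.2) =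
      ∑ a, ∑ b, u a ⬝ᵥ (Matrix.of fun j k => M (a, j) (b, k)) *ᵥ u b := by
  simp only [dotProduct, mulVec, Fintype.sum_prod_type, Matrix.of_apply, Finset.mul_sum]
  exact Finset.sum_congr rfl fun a _ => Finset.sum_comm

lemma dotProduct_Q02_mulVec {n r : ℕ} (A0 : Fin (r + 1) → Matrix (Fin n) (Fin n) ℝ)
    {P : Matrix (Fin n) (Fin n) ℝ} (hP : Pᵀ = P) (S : Fin r → Matrix (Fin n) (Fin n) ℝ)
    (u : Fin (r + 1) → Fin n → ℝ) :
    (fun p : Fin (r + 1) × Fin n => u p.1 p.2) ⬝ᵥ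
        Q02 A0 P S *ᵥ (fun p : Fin (r + 1) × Fin n => u p.1 p.2) =
      2 * (u 0 ⬝ᵥ P *ᵥ ∑ i, A0 i *ᵥ u i) +
        ∑ i : Fin r, (u 0 ⬝ᵥ S i *ᵥ u 0 - u i.succ ⬝ᵥ S i *ᵥ u i.succ) := by
  have h00 : (Matrix.of fun j k => Q02 A0 P S (0, j) (0, k)) =
      (A0 0)ᵀ * P + P * A0 0 + ∑ i, S i := by
    ext j k; simp [Q02]
  have h0s (b : Fin r) : (Matrix.of fun j k => Q02 A0 P S (0, j) (b.succ, k)) =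
      P * A0 b.succ := by
    ext j k; simp [Q02]
  have hs0 (a : Fin r) : (Matrix.of fun j k => Q02 A0 P S (a.succ, j) (0, k)) =
      (P * A0 a.succ)ᵀ := by
    ext j k; simp [Q02]
  have hss (a b : Fin r) : (Matrix.of fun j k => Q02 A0 P S (a.succ, j) (b.succ, k)) =
      if a = b then -S a else 0 := by
    ext j k
    by_cases h : a = b <;> simp [Q02, h]
  have htr (M : Matrix (Fin n) (Fin n) ℝ) (v w : Fin n → ℝ) :
      v ⬝ᵥ Mᵀ *ᵥ w = w ⬝ᵥ M *ᵥ v := by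
    rw [mulVec_transpose, dotProduct_comm, dotProduct_mulVec]
  have hA : (A0 0)ᵀ * P = (P * A0 0)ᵀ := by rw [transpose_mul, hP]
  have hdiag (a : Fin r) : ∑ b, u a.succ ⬝ᵥ (if a = b then -S a else 0) *ᵥ u b.succ =
      -(u a.succ ⬝ᵥ S a *ᵥ u a.succ) := by
    rw [Finset.sum_eq_single a]
    · simp [neg_mulVec]
    · intro b _ hb
      simp [hb.symm]
    · simp
  rw [dotProduct_mulVec_prod]
  simp only [Fin.sum_univ_succ, h00, h0s, hs0, hss, hA, htr, add_mulVec, dotProduct_add,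
    Finset.sum_add_distrib, hdiag, sum_mulVec, dotProduct_sum, mulVec_add, mulVec_sum,
    mulVec_mulVec, Finset.sum_neg_distrib, Finset.sum_sub_distrib]
  ring

/-- A uniformly Lipschitz trajectory along which a nonnegative functional is dissipated at a
rate at least `ε ‖x‖ ^ 2` converges to zero. -/
lemma tendsto_zero_of_dissipation {E : Type*} [NormedAddCommGroup E] {x : ℝ → E}
    {V V' : ℝ → ℝ} {a ε L : ℝ} (hε : 0 < ε) (hL : 0 < L) (hV : ∀ t ≥ a, 0 ≤ V t)
    (hderiv : ∀ t ≥ a, HasDerivAt V (V' t) t) (hdiss : ∀ t ≥ a, V' t ≤ -(ε * ‖x t‖ ^ 2))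
    (hlip : ∀ s ≥ a, ∀ t ≥ a, ‖x t - x s‖ ≤ L * |t - s|) :
    Tendsto x atTop (nhds 0) := by
  have hdrop : ∀ c, ∀ s ≥ a, ∀ t ≥ s, (∀ τ ∈ Set.Icc s t, c ≤ ε * ‖x τ‖ ^ 2) →
      V t ≤ V s - c * (t - s) := by
    intro c s hs t hst hτ
    have := (convex_Icc s t).image_sub_le_mul_sub_of_deriv_le (f := V) (C := -c)
      (fun τ hτ => (hderiv τ (hs.le.trans hτ.1)).continuousAt.continuousWithinAt)
      (fun τ hτ => (hderiv τ (hs.le.trans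
        (interior_subset hτ).1)).differentiableAt.differentiableWithinAt)
      (fun τ hτ' => by
        have hm := interior_subset hτ'
        rw [(hderiv τ (hs.le.trans hm.1)).deriv]
        linarith [hdiss τ (hs.le.trans hm.1), hτ τ hm])
      s (Set.left_mem_Icc.mpr hst) t (Set.right_mem_Icc.mpr hst) hst
    linarith
  have hanti : Antitone fun t => V (max a t) := fun s t hst => by
    have := hdrop 0 (max a s) (le_max_left _ _) (max a t) (max_le_max le_rfl hst)
      (fun τ _ => by positivity)
    simpa using this
  have hlim := tendsto_atTop_ciInf hanti
    ⟨0, by rintro _ ⟨t, rfl⟩; exact hV _ (le_max_left _ _)⟩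
  rw [Metric.tendsto_nhds]
  intro δ hδ
  set w := δ / (2 * L) with hw
  have hwpos : 0 < w := by positivity
  have hzero : Tendsto (fun t => V (max a t) - V (max a (t + w))) atTop (nhds 0) := by
    simpa using hlim.sub (hlim.comp (tendsto_atTop_add_const_right atTop w tendsto_id))
  have hm : 0 < ε * (δ / 2) ^ 2 * w := by positivity
  filter_upwards [hzero.eventually_lt_const hm, eventually_ge_atTop a] with t ht hat
  rw [dist_zero_right]
  by_contra! hx
  rw [max_eq_right hat, max_eq_right (by linarith)] at ht
  have := hdrop (ε * (δ / 2) ^ 2) t hat (t + w) (by linarith) fun τ hτ => by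
    have h1 := hlip t hat τ (hat.trans hτ.1)
    rw [abs_of_nonneg (by linarith [hτ.1])] at h1
    have h2 : L * (τ - t) ≤ δ / 2 := by
      calc L * (τ - t) ≤ L * w := by gcongr; linarith [hτ.2]
        _ = δ / 2 := by rw [hw]; field_simp
    have h3 := norm_sub_norm_le (x t) (x τ)
    rw [norm_sub_rev] at h3
    have h4 : δ / 2 ≤ ‖x τ‖ := by linarith
    gcongr
  linarith

/-- Derivative of a quadratic form with symmetric matrix along a differentiable curve. -/
lemma HasDerivAt.dotProduct_mulVec_self {ι : Type*} [Fintype ι] {M : Matrix ι ι ℝ}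
    (hM : Mᵀ = M) {x : ℝ → ι → ℝ} {x' : ι → ℝ} {t : ℝ} (hx : HasDerivAt x x' t) :
    HasDerivAt (fun s => x s ⬝ᵥ M *ᵥ x s) (2 * (x t ⬝ᵥ M *ᵥ x')) t := by
  rw [hasDerivAt_pi] at hx
  have h : HasDerivAt (fun s => ∑ i, x s i * ∑ j, M i j * x s j)
      (∑ i, (x' i * ∑ j, M i j * x t j + x t i * ∑ j, M i j * x' j)) t :=
    HasDerivAt.fun_sum fun i _ => (hx i).mul
      (HasDerivAt.fun_sum fun j _ => (hx j).const_mul (M i j))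
  have hsymm : x' ⬝ᵥ M *ᵥ x t = x t ⬝ᵥ M *ᵥ x' := by
    rw [dotProduct_mulVec, ← mulVec_transpose, hM, dotProduct_comm]
  refine h.congr_deriv ?_
  rw [Finset.sum_add_distrib, two_mul]
  exact congrArg (· + x t ⬝ᵥ M *ᵥ x') hsymm

/-- **Corollary 2, stability part (nominal, uncertainty-free system).**
If there exist `P = Pᵀ > 0` and `Sᵢ = Sᵢᵀ > 0` with `Q₀⁽²⁾ < 0`, then for every choice of
delays `hᵢ ≥ 0` (with `h₀ = 0`) every solution of `ẋ(t) = ∑ᵢ A₀ᵢ x(t − hᵢ)` is bounded and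
tends to `0` as `t → ∞`. -/
theorem corollary2_nominal_stability (n r : ℕ) (hn : 1 ≤ n) (hr : 1 ≤ r)
    (A0 : Fin (r + 1) → Matrix (Fin n) (Fin n) ℝ)
    (P : Matrix (Fin n) (Fin n) ℝ) (hPsym : Pᵀ = P) (hP : P.PosDef)
    (S : Fin r → Matrix (Fin n) (Fin n) ℝ)
    (hSsym : ∀ i, (S i)ᵀ = S i) (hS : ∀ i, (S i).PosDef)
    (hQ : (-(Q02 A0 P S)).PosDef) :
    ∀ hdel : Fin (r + 1) → ℝ, hdel 0 = 0 → (∀ i, 0 ≤ hdel i) →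
      ∀ x : ℝ → Fin n → ℝ,
        ContinuousOn x (Set.Ici (-(⨆ i, hdel i))) →
        (∀ t > (0 : ℝ), HasDerivAt x (∑ i, (A0 i).mulVec (x (t - hdel i))) t) →
        (∃ C : ℝ, ∀ t ≥ -(⨆ i, hdel i), ‖x t‖ ≤ C) ∧
          Tendsto x atTop (nhds 0) := by
  intro hdel h0 hnn x hcont hderiv
  set H := ⨆ i, hdel i
  have hle (i) : hdel i ≤ H := le_ciSup (Set.finite_range hdel).bddAbove i
  have hH0 : 0 ≤ H := h0 ▸ hle 0
  obtain ⟨y, hy, hyx⟩ : ∃ y : ℝ → Fin n → ℝ, Continuous y ∧ ∀ t ≥ -H, y t = x t :=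
    ⟨fun t => x (max (-H) t),
      hcont.comp_continuous (by fun_prop) fun t => Set.mem_Ici.mpr (le_max_left _ _),
      fun t ht => by simp only [max_eq_right ht.le]⟩
  obtain ⟨c, hc, hPc⟩ := hP.exists_pos_mul_sq_norm_le
  obtain ⟨ε, hε, hQε⟩ := hQ.exists_pos_mul_sq_norm_le
  have hgc (i : Fin r) : Continuous fun s => y s ⬝ᵥ S i *ᵥ y s := by fun_prop
  set F : Fin r → ℝ → ℝ := fun i t => ∫ s in (0 : ℝ)..t, y s ⬝ᵥ S i *ᵥ y s
  have hFd (i t) : HasDerivAt (F i) (y t ⬝ᵥ S i *ᵥ y t) t :=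
    (hgc i).integral_hasStrictDerivAt 0 t |>.hasDerivAt
  have hFmono (i) : Monotone (F i) := monotone_of_hasDerivAt_nonneg (hFd i) fun t => by
    simpa using (hS i).posSemidef.dotProduct_mulVec_nonneg (y t)
  set V : ℝ → ℝ := fun t =>
    x t ⬝ᵥ P *ᵥ x t + ∑ i : Fin r, (F i t - F i (t - hdel i.succ))
  set V' : ℝ → ℝ := fun t => 2 * (x t ⬝ᵥ P *ᵥ ∑ i, A0 i *ᵥ x (t - hdel i)) +
    ∑ i : Fin r, (x t ⬝ᵥ S i *ᵥ x t -
      x (t - hdel i.succ) ⬝ᵥ S i *ᵥ x (t - hdel i.succ))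
  have hVd : ∀ t ≥ (1 : ℝ), HasDerivAt V (V' t) t := by
    intro t ht
    refine ((hderiv t (by linarith)).dotProduct_mulVec_self hPsym).add
      (HasDerivAt.fun_sum fun i _ => ?_)
    rw [← hyx t (by linarith), ← hyx (t - hdel i.succ) (by linarith [hle i.succ])]
    exact (hFd i t).sub ((hFd i _).comp_sub_const t _)
  have hVdiss : ∀ t ≥ (1 : ℝ), V' t ≤ -(ε * ‖x t‖ ^ 2) := by
    intro t ht
    have h1 := hQε fun p => x (t - hdel p.1) p.2
    have h2 := dotProduct_Q02_mulVec A0 hPsym S fun i => x (t - hdel i)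
    rw [neg_mulVec, dotProduct_neg, h2] at h1
    have h3 : ‖x t‖ ≤ ‖fun p : Fin (r + 1) × Fin n => x (t - hdel p.1) p.2‖ := by
      refine (pi_norm_le_iff_of_nonneg (norm_nonneg _)).mpr fun j => ?_
      simpa [h0] using norm_le_pi_norm
        (fun p : Fin (r + 1) × Fin n => x (t - hdel p.1) p.2) (0, j)
    have h4 : ε * ‖x t‖ ^ 2 ≤
        ε * ‖fun p : Fin (r + 1) × Fin n => x (t - hdel p.1) p.2‖ ^ 2 := by gcongr
    simp only [h0, sub_zero] at h1
    linarith
  have hVlow (t : ℝ) : c * ‖x t‖ ^ 2 ≤ V t := by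
    have : 0 ≤ ∑ i : Fin r, (F i t - F i (t - hdel i.succ)) :=
      Finset.sum_nonneg fun i _ => sub_nonneg.mpr (hFmono i (by linarith [hnn i.succ]))
    linarith [hPc (x t)]
  have hVanti : AntitoneOn V (Set.Ici 1) :=
    antitoneOn_of_hasDerivWithinAt_nonpos (f' := V') (convex_Ici 1)
      (fun t ht => (hVd t ht).continuousAt.continuousWithinAt)
      (fun t ht => (hVd t (interior_subset ht)).hasDerivWithinAt)
      (fun t ht => (hVdiss t (interior_subset ht)).trans (by
        have : 0 ≤ ε * ‖x t‖ ^ 2 := by positivity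
        linarith))
  obtain ⟨C₁, hC₁⟩ := (isCompact_Icc (a := -H) (b := 1)).exists_bound_of_continuousOn
    (hcont.mono Set.Icc_subset_Ici_self)
  have hbdd : ∀ t ≥ -H, ‖x t‖ ≤ max C₁ (V 1 / c + 1) := by
    intro t ht
    rcases le_total t 1 with h | h
    · exact (hC₁ t ⟨ht, h⟩).trans (le_max_left _ _)
    · have h1 : ‖x t‖ ^ 2 ≤ V 1 / c := by
        rw [le_div_iff₀ hc, mul_comm]
        exact (hVlow t).trans (hVanti Set.self_mem_Ici h h)
      exact le_trans (by nlinarith [sq_nonneg (‖x t‖ - 1)]) (le_max_right _ _)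
  refine ⟨⟨_, hbdd⟩, ?_⟩
  obtain ⟨K, hK⟩ := (isCompact_closedBall (0 : Fin (r + 1) → Fin n → ℝ)
    (max C₁ (V 1 / c + 1))).exists_bound_of_continuousOn
    (f := fun u => ∑ i, A0 i *ᵥ u i) (by fun_prop)
  have hx' : ∀ t ≥ (1 : ℝ), ‖∑ i, A0 i *ᵥ x (t - hdel i)‖ ≤ max K 1 := fun t ht =>
    (hK (fun i => x (t - hdel i)) (mem_closedBall_zero_iff.mpr
      (pi_norm_le_iff_of_nonempty _ |>.mpr fun i =>
        hbdd _ (by linarith [hle i])))).trans (le_max_left _ _)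
  refine tendsto_zero_of_dissipation (L := max K 1) hε (by positivity)
    (fun t _ => le_trans (by positivity) (hVlow t)) hVd hVdiss fun s hs t ht => ?_
  exact (convex_Ici (1 : ℝ)).norm_image_sub_le_of_norm_hasDerivWithin_le
    (fun τ hτ => (hderiv τ (by linarith [Set.mem_Ici.mp hτ])).hasDerivWithinAt) hx' hs ht
end

section
/- If there exist real matrices P = Pᵀ > 0 and S_i = S_iᵀ > 0 (i = 1,…,r) such that Q_0^{(2)} < 0, then the matrix Σ_{i=0}^r A_{0i} is a stability matrix, i.e., every eigenvalue of Σ_{i=0}^r A_{0i} regarded as a complex matrix has strictly negative real part. (In particular, Q_0^{(2)} < 0 implies (Σ_{i=0}^r A_{0i})ᵀP + P(Σ_{i=0}^r A_{0i}) < 0.) -/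
open Matrix

/-- Summing all blocks of `Q₀⁽²⁾` cancels the `Sᵢ` and leaves the Lyapunov operator of `∑ᵢ A₀ᵢ`. -/
lemma sum_blocks_Q02 {n r : ℕ} (A0 : Fin (r + 1) → Matrix (Fin n) (Fin n) ℝ)
    (P : Matrix (Fin n) (Fin n) ℝ) (hP : Pᵀ = P) (S : Fin r → Matrix (Fin n) (Fin n) ℝ)
    (a b : Fin n) :
    ∑ i, ∑ j, Q02 A0 P S (i, a) (j, b) = ((∑ i, A0 i)ᵀ * P + P * ∑ i, A0 i) a b := by
  have h : ∀ i, ((A0 i)ᵀ * P) a b = (P * A0 i) b a := fun i => by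
    rw [← transpose_apply (P * A0 i), transpose_mul, hP]
  simp only [Q02, of_apply, Fin.sum_univ_succ (n := r), Fin.succ_ne_zero, Fin.succ_inj,
    dif_neg, dif_pos, if_true, if_false, not_false_eq_true, Fin.pred_succ, transpose_add,
    transpose_sum, add_mul, mul_add, Finset.sum_mul, Finset.mul_sum, Matrix.add_apply, Matrix.sum_apply,
    h, transpose_apply, Matrix.neg_apply, Finset.sum_add_distrib, Finset.sum_ite_eq, Finset.mem_univ,
    Finset.sum_neg_distrib]
  ring

/-- Negative definiteness of `Q₀⁽²⁾` gives the Lyapunov inequality for `∑ᵢ A₀ᵢ`. -/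
lemma posDef_neg_lyapunov_of_posDef_neg_Q02 {n r : ℕ}
    (A0 : Fin (r + 1) → Matrix (Fin n) (Fin n) ℝ)
    (P : Matrix (Fin n) (Fin n) ℝ) (hP : Pᵀ = P) (S : Fin r → Matrix (Fin n) (Fin n) ℝ)
    (hQ : (-(Q02 A0 P S)).PosDef) :
    (-((∑ i, A0 i)ᵀ * P + P * ∑ i, A0 i)).PosDef := by
  let E : Matrix (Fin (r + 1) × Fin n) (Fin n) ℝ := of fun p b => if p.2 = b then 1 else 0
  have hE : Function.Injective E.mulVec := fun x y hxy => by
    ext a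
    simpa [E, mulVec, dotProduct] using congrFun hxy (0, a)
  have hsum : Eᴴ * Q02 A0 P S * E = (∑ i, A0 i)ᵀ * P + P * ∑ i, A0 i := by
    ext a b
    rw [← sum_blocks_Q02 A0 P hP S, Matrix.mul_assoc]
    simp [E, mul_apply, Fintype.sum_prod_type]
  have hpos := hQ.conjTranspose_mul_mul_same hE
  rwa [Matrix.mul_neg, Matrix.neg_mul, hsum] at hpos

/-- Lyapunov's criterion: `P > 0` and `AᵀP + PA < 0` force the spectrum of `A` into the open
left half-plane. -/
lemma re_neg_of_mem_spectrum_of_lyapunov {ι : Type*} [Fintype ι] [DecidableEq ι]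
    {A P : Matrix ι ι ℝ} (hP : P.PosDef) (hA : (-(Aᵀ * P + P * A)).PosDef)
    {μ : ℂ} (hμ : μ ∈ spectrum ℂ (A.map (Complex.ofReal ·))) : μ.re < 0 := by
  rw [← Matrix.spectrum_toLin', ← Module.End.hasEigenvalue_iff_mem_spectrum] at hμ
  obtain ⟨v, hv⟩ := hμ.exists_hasEigenvector
  have hv0 := hv.2
  have hAv : A.map (Complex.ofReal ·) *ᵥ v = μ • v := by simpa using hv.apply_eq_smul
  set x : ι → ℝ := fun i => (v i).re
  set y : ι → ℝ := fun i => (v i).im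
  have hAx : A *ᵥ x = μ.re • x - μ.im • y := by
    ext i
    simpa [mulVec, dotProduct, x, y] using congrArg Complex.re (congrFun hAv i)
  have hAy : A *ᵥ y = μ.re • y + μ.im • x := by
    ext i
    simpa [mulVec, dotProduct, x, y] using congrArg Complex.im (congrFun hAv i)
  have hsymm : ∀ u w : ι → ℝ, u ⬝ᵥ P *ᵥ w = w ⬝ᵥ P *ᵥ u := fun u w => by
    have hPt : Pᵀ = P := by simpa using hP.isHermitian.eq
    rw [dotProduct_comm, dotProduct_mulVec, ← mulVec_transpose, hPt]
  have hform : ∀ u : ι → ℝ, u ⬝ᵥ (-(Aᵀ * P + P * A)) *ᵥ u = -2 * (u ⬝ᵥ P *ᵥ (A *ᵥ u)) := by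
    intro u
    have : u ⬝ᵥ Aᵀ *ᵥ (P *ᵥ u) = u ⬝ᵥ P *ᵥ (A *ᵥ u) := by
      rw [hsymm u, dotProduct_mulVec, vecMul_transpose]
    rw [neg_mulVec, add_mulVec, ← mulVec_mulVec, ← mulVec_mulVec, dotProduct_neg,
      dotProduct_add, this]
    ring
  have pos : ∀ {M : Matrix ι ι ℝ}, M.PosDef → 0 < x ⬝ᵥ M *ᵥ x + y ⬝ᵥ M *ᵥ y := by
    intro M hM
    have hnn : ∀ u : ι → ℝ, 0 ≤ u ⬝ᵥ M *ᵥ u := fun u => by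
      simpa using hM.posSemidef.dotProduct_mulVec_nonneg u
    by_cases hx0 : x = 0
    · have hy0 : y ≠ 0 := fun hy0 =>
        hv0 (funext fun i => Complex.ext (congrFun hx0 i) (congrFun hy0 i))
      exact add_pos_of_nonneg_of_pos (hnn x) (by simpa using hM.dotProduct_mulVec_pos hy0)
    · exact add_pos_of_pos_of_nonneg (by simpa using hM.dotProduct_mulVec_pos hx0) (hnn y)
  have h1 := pos hP
  have h2 := pos hA
  rw [hform, hform, hAx, hAy] at h2
  simp only [mulVec_sub, mulVec_add, mulVec_smul, dotProduct_sub, dotProduct_add,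
    dotProduct_smul, smul_eq_mul, hsymm y x] at h2
  by_contra! hre
  nlinarith [mul_nonneg hre h1.le]

/-- If there exist `P = Pᵀ > 0` and `Sᵢ = Sᵢᵀ > 0` such that `Q₀⁽²⁾ < 0`, then
`∑ᵢ A₀ᵢ` is a stability matrix (every eigenvalue, over `ℂ`, has strictly negative real part);
in particular `(∑ᵢ A₀ᵢ)ᵀ P + P (∑ᵢ A₀ᵢ) < 0`. -/
theorem corollary2_sum_hurwitz (n r : ℕ) (hn : 1 ≤ n) (hr : 1 ≤ r)
    (A0 : Fin (r + 1) → Matrix (Fin n) (Fin n) ℝ)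
    (P : Matrix (Fin n) (Fin n) ℝ) (hPsym : Pᵀ = P) (hP : P.PosDef)
    (S : Fin r → Matrix (Fin n) (Fin n) ℝ)
    (hSsym : ∀ i, (S i)ᵀ = S i) (hS : ∀ i, (S i).PosDef)
    (hQ : (-(Q02 A0 P S)).PosDef) :
    (-(((∑ i, A0 i)ᵀ) * P + P * (∑ i, A0 i))).PosDef ∧
      ∀ μ ∈ spectrum ℂ ((∑ i, A0 i).map (Complex.ofReal ·)), μ.re < 0 := by
  have hL := posDef_neg_lyapunov_of_posDef_neg_Q02 A0 P hPsym S hQ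
  exact ⟨hL, fun μ hμ => re_neg_of_mem_spectrum_of_lyapunov hP hL hμ⟩
end

section
/- Corollary 3 (delay-independent stability via vertex tests). Suppose there exist real matrices P = Pᵀ > 0 (n×n), S_i = S_iᵀ > 0 (n×n, i = 1,…,r), and M_i = M_iᵀ > 0 (d_i×d_i, i = 0,…,r) such that for every tuple of vertex indices (k_0,…,k_r) with each k_j ∈ {1,…,v}, the real symmetric matrix Q^{(3)}(k_0,…,k_r) of size n(r+1)+d is negative definite, where, writing Δ_i^{(k_i)} = Δ_i(θ^{(k_i)}), the rows and columns are grouped into a first block of size n, blocks 2,…,r+1 each of size n, and blocks r+2,…,2r+2 of sizes d_0,…,d_r, and the blocks on and above the diagonal are: Q_{1,1} = A_{00}ᵀP + P A_{00} + Σ_{i=1}^r S_i + C_{p0}ᵀ M_0 C_{p0}; Q_{1,1+i} = P A_{0i} (i = 1,…,r); Q_{1,r+2} = P B_{q0}Δ_0^{(k_0)} + C_{p0}ᵀ M_0 D_{pq0}Δ_0^{(k_0)}; Q_{1,r+2+i} = P B_{qi}Δ_i^{(k_i)} (i = 1,…,r); Q_{1+i,1+i} = C_{pi}ᵀ M_i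 C_{pi} − S_i (i = 1,…,r); Q_{1+i,r+2+i} = C_{pi}ᵀ M_i D_{pqi}Δ_i^{(k_i)} (i = 1,…,r); Q_{r+2+i,r+2+i} = −M_i + (D_{pqi}Δ_i^{(k_i)})ᵀ M_i (D_{pqi}Δ_i^{(k_i)}) (i = 0,…,r); all other blocks above the diagonal are zero and blocks below the diagonal are transposes of those above. Then the unforced delayed system is globally asymptotically stable independent of the delays. -/
open Matrix Filter

/-- The real symmetric matrix `Q⁽³⁾` of Corollary 3 (for a fixed family `Δ i = Δᵢ^{(kᵢ)}`):
rows/columns are grouped into a first block of size `n` (index `Sum.inl (0, ·)`), blocks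
`2, …, r+1` of size `n` (index `Sum.inl (i, ·)`, `i ≠ 0`), and uncertainty blocks of sizes
`d₀, …, d_r` (index `Sum.inr ⟨i, ·⟩`). -/
noncomputable def Q3 {n r m : ℕ} (s : Fin (r + 1) → Fin m → ℕ)
    (A0 : Fin (r + 1) → Matrix (Fin n) (Fin n) ℝ)
    (Bq : (i : Fin (r + 1)) → Matrix (Fin n) (DIdx s i) ℝ)
    (Cp : (i : Fin (r + 1)) → Matrix (DIdx s i) (Fin n) ℝ)
    (Dpq : (i : Fin (r + 1)) → Matrix (DIdx s i) (DIdx s i) ℝ)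
    (P : Matrix (Fin n) (Fin n) ℝ) (S : Fin r → Matrix (Fin n) (Fin n) ℝ)
    (M : (i : Fin (r + 1)) → Matrix (DIdx s i) (DIdx s i) ℝ)
    (Δ : (i : Fin (r + 1)) → Matrix (DIdx s i) (DIdx s i) ℝ) :
    Matrix ((Fin (r + 1) × Fin n) ⊕ ((i : Fin (r + 1)) × DIdx s i))
      ((Fin (r + 1) × Fin n) ⊕ ((i : Fin (r + 1)) × DIdx s i)) ℝ :=
  Matrix.of fun p q =>
    match p, q with
    | Sum.inl (i, a), Sum.inl (j, b) =>
      if hi : i = 0 then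
        if j = 0 then
          ((A0 0)ᵀ * P + P * A0 0 + (∑ l : Fin r, S l) + (Cp 0)ᵀ * M 0 * Cp 0) a b
        else (P * A0 j) a b
      else
        if j = 0 then (P * A0 i)ᵀ a b
        else if i = j then ((Cp i)ᵀ * M i * Cp i - S (i.pred hi)) a b
        else 0
    | Sum.inl (i, a), Sum.inr ⟨j, b⟩ =>
      if i = 0 then
        if j = 0 then (P * Bq j * Δ j + (Cp j)ᵀ * M j * (Dpq j * Δ j)) a b
        else (P * Bq j * Δ j) a b
      else if i = j then ((Cp j)ᵀ * M j * (Dpq j * Δ j)) a b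
      else 0
    | Sum.inr ⟨i, a⟩, Sum.inl (j, b) =>
      if j = 0 then
        if i = 0 then (P * Bq i * Δ i + (Cp i)ᵀ * M i * (Dpq i * Δ i)) b a
        else (P * Bq i * Δ i) b a
      else if j = i then ((Cp i)ᵀ * M i * (Dpq i * Δ i)) b a
      else 0
    | Sum.inr ⟨i, a⟩, Sum.inr ⟨j, b⟩ =>
      if hij : j = i then (-(M i) + (Dpq i * Δ i)ᵀ * M i * (Dpq i * Δ i)) a (hij ▸ b)
      else 0

/-- A positive definite quadratic form dominates a multiple of the squared norm. -/
theorem Matrix.PosDef.exists_mul_sq_norm_le {ι : Type*} [Fintype ι] {N : Matrix ι ι ℝ}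
    (hN : N.PosDef) : ∃ ε > 0, ∀ z : ι → ℝ, ε * ‖z‖ ^ 2 ≤ z ⬝ᵥ N *ᵥ z := by
  have hcont : Continuous fun z : ι → ℝ => z ⬝ᵥ N *ᵥ z := by fun_prop
  rcases (Metric.sphere (0 : ι → ℝ) 1).eq_empty_or_nonempty with he | hne
  · refine ⟨1, one_pos, fun z => ?_⟩
    have hz : z = 0 := by
      by_contra hz
      have : ‖z‖⁻¹ • z ∈ Metric.sphere (0 : ι → ℝ) 1 := by
        simp [norm_smul, inv_mul_cancel₀ (norm_ne_zero_iff.mpr hz)]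
      simp [he] at this
    simp [hz]
  · obtain ⟨z₀, hz₀, hmin⟩ := (isCompact_sphere (0 : ι → ℝ) 1).exists_isMinOn hne
      hcont.continuousOn
    have hz₀' : z₀ ≠ 0 := by
      rintro rfl
      simp at hz₀
    refine ⟨z₀ ⬝ᵥ N *ᵥ z₀, by simpa using hN.dotProduct_mulVec_pos hz₀', fun z => ?_⟩
    by_cases hz : z = 0
    · simp [hz]
    have hzn : ‖z‖ ≠ 0 := norm_ne_zero_iff.mpr hz
    have hmem : ‖z‖⁻¹ • z ∈ Metric.sphere (0 : ι → ℝ) 1 := by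
      simp [norm_smul, inv_mul_cancel₀ hzn]
    have h : z₀ ⬝ᵥ N *ᵥ z₀ ≤ (‖z‖⁻¹ • z) ⬝ᵥ N *ᵥ (‖z‖⁻¹ • z) := hmin hmem
    calc z₀ ⬝ᵥ N *ᵥ z₀ * ‖z‖ ^ 2
        ≤ (‖z‖⁻¹ • z) ⬝ᵥ N *ᵥ (‖z‖⁻¹ • z) * ‖z‖ ^ 2 := by gcongr
      _ = z ⬝ᵥ N *ᵥ z := by
        simp only [mulVec_smul, smul_dotProduct, dotProduct_smul, smul_eq_mul]
        field_simp

/-- A quadratic form is bounded above by a multiple of the squared norm. -/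
theorem Matrix.exists_dotProduct_mulVec_le {ι : Type*} [Fintype ι] (N : Matrix ι ι ℝ) :
    ∃ K > 0, ∀ z : ι → ℝ, z ⬝ᵥ N *ᵥ z ≤ K * ‖z‖ ^ 2 := by
  have hcont : Continuous fun z : ι → ℝ => z ⬝ᵥ N *ᵥ z := by fun_prop
  obtain ⟨K, hK⟩ := (isCompact_sphere (0 : ι → ℝ) 1).bddAbove_image hcont.continuousOn
  refine ⟨max K 1, by positivity, fun z => ?_⟩
  by_cases hz : z = 0
  · simp [hz]
  have hzn : ‖z‖ ≠ 0 := norm_ne_zero_iff.mpr hz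
  have h : (‖z‖⁻¹ • z) ⬝ᵥ N *ᵥ (‖z‖⁻¹ • z) ≤ K :=
    hK ⟨_, by simp [norm_smul, inv_mul_cancel₀ hzn], rfl⟩
  calc z ⬝ᵥ N *ᵥ z = (‖z‖⁻¹ • z) ⬝ᵥ N *ᵥ (‖z‖⁻¹ • z) * ‖z‖ ^ 2 := by
        simp only [mulVec_smul, smul_dotProduct, dotProduct_smul, smul_eq_mul]
        field_simp
    _ ≤ max K 1 * ‖z‖ ^ 2 := by
        gcongr
        exact h.trans (le_max_left _ _)

theorem Matrix.dotProduct_mulVec_comm_of_isSymm {ι : Type*} [Fintype ι] {N : Matrix ι ι ℝ}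
    (hN : Nᵀ = N) (u w : ι → ℝ) : u ⬝ᵥ N *ᵥ w = w ⬝ᵥ N *ᵥ u := by
  rw [← dotProduct_transpose_mulVec, hN]

/-- The quadratic form of a positive definite matrix is convex. -/
theorem Matrix.PosDef.convexOn_dotProduct_mulVec {ι : Type*} [Fintype ι] {N : Matrix ι ι ℝ}
    (hN : N.PosDef) : ConvexOn ℝ Set.univ fun z : ι → ℝ => z ⬝ᵥ N *ᵥ z := by
  refine ⟨convex_univ, fun u _ w _ a b ha hb hab => ?_⟩
  have h : 0 ≤ (u - w) ⬝ᵥ N *ᵥ (u - w) := by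
    simpa using hN.posSemidef.dotProduct_mulVec_nonneg (u - w)
  have hb' : b = 1 - a := by linarith
  subst hb'
  simp only [mulVec_add, mulVec_sub, mulVec_smul, add_dotProduct, sub_dotProduct, dotProduct_add,
    dotProduct_sub, smul_dotProduct, dotProduct_smul, smul_eq_mul] at h ⊢
  nlinarith [mul_nonneg (mul_nonneg ha hb) h]

theorem sum_block_comm {κ : Type*} [Fintype κ] {e e' : κ → Type*} [∀ i, Fintype (e i)]
    [∀ i, Fintype (e' i)] (f : ∀ i, e i → ∀ j, e' j → ℝ) :
    (∑ i, ∑ a, ∑ j, ∑ b, f i a j b) = ∑ i, ∑ j, ∑ a, ∑ b, f i a j b :=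
  Finset.sum_congr rfl fun _ _ => Finset.sum_comm

/-- The quadratic form of a block-indexed matrix, expanded over blocks. -/
theorem dotProduct_mulVec_sum_blocks {κ ι : Type*} {d : κ → Type*} [Fintype κ] [Fintype ι]
    [∀ i, Fintype (d i)]
    (N : Matrix ((κ × ι) ⊕ ((i : κ) × d i)) ((κ × ι) ⊕ ((i : κ) × d i)) ℝ)
    (y : κ → ι → ℝ) (w : (i : κ) → d i → ℝ) :
    (Sum.elim (fun p => y p.1 p.2) fun p => w p.1 p.2) ⬝ᵥ
        N *ᵥ (Sum.elim (fun p => y p.1 p.2) fun p => w p.1 p.2) =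
      (∑ i, ∑ j, y i ⬝ᵥ (Matrix.of fun a b => N (Sum.inl (i, a)) (Sum.inl (j, b))) *ᵥ y j) +
      (∑ i, ∑ j, y i ⬝ᵥ (Matrix.of fun a b => N (Sum.inl (i, a)) (Sum.inr ⟨j, b⟩)) *ᵥ w j) +
      (∑ i, ∑ j, w i ⬝ᵥ (Matrix.of fun a b => N (Sum.inr ⟨i, a⟩) (Sum.inl (j, b))) *ᵥ y j) +
      (∑ i, ∑ j, w i ⬝ᵥ (Matrix.of fun a b => N (Sum.inr ⟨i, a⟩) (Sum.inr ⟨j, b⟩)) *ᵥ w j) := by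
  simp only [dotProduct, mulVec, Fintype.sum_sum_type, Fintype.sum_prod_type, Fintype.sum_sigma,
    Sum.elim_inl, Sum.elim_inr, Matrix.of_apply, mul_add, Finset.sum_add_distrib, Finset.mul_sum]
  rw [sum_block_comm (e := fun _ => ι) (e' := fun _ => ι), sum_block_comm (e := fun _ => ι),
    sum_block_comm (e' := fun _ => ι), sum_block_comm]
  ring

section
variable {n r m : ℕ} (s : Fin (r + 1) → Fin m → ℕ)
    (A0 : Fin (r + 1) → Matrix (Fin n) (Fin n) ℝ)
    (Bq : (i : Fin (r + 1)) → Matrix (Fin n) (DIdx s i) ℝ)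
    (Cp : (i : Fin (r + 1)) → Matrix (DIdx s i) (Fin n) ℝ)
    (Dpq : (i : Fin (r + 1)) → Matrix (DIdx s i) (DIdx s i) ℝ)
    (P : Matrix (Fin n) (Fin n) ℝ) (S : Fin r → Matrix (Fin n) (Fin n) ℝ)
    (M : (i : Fin (r + 1)) → Matrix (DIdx s i) (DIdx s i) ℝ)

/-- The part of the quadratic form of `Q3` that depends on the `i`-th uncertainty. -/
noncomputable def channelForm (y : Fin (r + 1) → Fin n → ℝ) (i : Fin (r + 1))
    (w : DIdx s i → ℝ) (Δ : Matrix (DIdx s i) (DIdx s i) ℝ) : ℝ :=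
  2 * (y 0 ⬝ᵥ P *ᵥ Bq i *ᵥ Δ *ᵥ w) +
    (Cp i *ᵥ y i + Dpq i *ᵥ Δ *ᵥ w) ⬝ᵥ M i *ᵥ (Cp i *ᵥ y i + Dpq i *ᵥ Δ *ᵥ w)

theorem dotProduct_Q3_mulVec (hPsym : Pᵀ = P) (hMsym : ∀ i, (M i)ᵀ = M i)
    (Δ : (i : Fin (r + 1)) → Matrix (DIdx s i) (DIdx s i) ℝ)
    (y : Fin (r + 1) → Fin n → ℝ) (w : (i : Fin (r + 1)) → DIdx s i → ℝ) :
    (Sum.elim (fun p => y p.1 p.2) fun p => w p.1 p.2) ⬝ᵥ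
        Q3 s A0 Bq Cp Dpq P S M Δ *ᵥ (Sum.elim (fun p => y p.1 p.2) fun p => w p.1 p.2) =
      2 * (y 0 ⬝ᵥ P *ᵥ ∑ i, A0 i *ᵥ y i) + ∑ l, y 0 ⬝ᵥ S l *ᵥ y 0 -
        ∑ l : Fin r, y l.succ ⬝ᵥ S l *ᵥ y l.succ +
        ∑ i, (channelForm s Bq Cp Dpq P M y i (w i) (Δ i) - w i ⬝ᵥ M i *ᵥ w i) := by
  have hT : ∀ i j, w i ⬝ᵥ (Matrix.of fun a b => Q3 s A0 Bq Cp Dpq P S M Δ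
      (Sum.inr ⟨i, a⟩) (Sum.inl (j, b))) *ᵥ y j = y j ⬝ᵥ (Matrix.of fun a b =>
        Q3 s A0 Bq Cp Dpq P S M Δ (Sum.inl (j, a)) (Sum.inr ⟨i, b⟩)) *ᵥ w i := by
    intro i j
    rw [← dotProduct_transpose_mulVec]
    rfl
  have h00 : (Matrix.of fun a b => Q3 s A0 Bq Cp Dpq P S M Δ (Sum.inl (0, a)) (Sum.inl (0, b))) =
      (A0 0)ᵀ * P + P * A0 0 + (∑ l : Fin r, S l) + (Cp 0)ᵀ * M 0 * Cp 0 := by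
    ext a b; simp [Q3]
  have h0s (j : Fin r) : (Matrix.of fun a b => Q3 s A0 Bq Cp Dpq P S M Δ (Sum.inl (0, a))
      (Sum.inl (j.succ, b))) = P * A0 j.succ := by
    ext a b; simp [Q3]
  have hs0 (j : Fin r) : (Matrix.of fun a b => Q3 s A0 Bq Cp Dpq P S M Δ (Sum.inl (j.succ, a))
      (Sum.inl (0, b))) = (P * A0 j.succ)ᵀ := by
    ext a b; simp [Q3]
  have hss (i j : Fin r) : (Matrix.of fun a b => Q3 s A0 Bq Cp Dpq P S M Δ (Sum.inl (i.succ, a))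
      (Sum.inl (j.succ, b))) =
      if i = j then (Cp i.succ)ᵀ * M i.succ * Cp i.succ - S i else 0 := by
    ext a b
    rcases eq_or_ne i j with rfl | h
    · simp [Q3]
    · simp [Q3, h]
  have g00 : (Matrix.of fun a b => Q3 s A0 Bq Cp Dpq P S M Δ (Sum.inl (0, a)) (Sum.inr ⟨0, b⟩)) =
      P * Bq 0 * Δ 0 + (Cp 0)ᵀ * M 0 * (Dpq 0 * Δ 0) := by
    ext a b; simp [Q3]
  have g0s (j : Fin r) : (Matrix.of fun a b => Q3 s A0 Bq Cp Dpq P S M Δ (Sum.inl (0, a))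
      (Sum.inr ⟨j.succ, b⟩)) = P * Bq j.succ * Δ j.succ := by
    ext a b; simp [Q3]
  have gs0 (j : Fin r) : (Matrix.of fun a b => Q3 s A0 Bq Cp Dpq P S M Δ (Sum.inl (j.succ, a))
      (Sum.inr ⟨0, b⟩)) = 0 := by
    ext a b; simp [Q3]
  have gss (i j : Fin r) : (Matrix.of fun a b => Q3 s A0 Bq Cp Dpq P S M Δ (Sum.inl (i.succ, a))
      (Sum.inr ⟨j.succ, b⟩)) =
      if i = j then (Cp j.succ)ᵀ * M j.succ * (Dpq j.succ * Δ j.succ) else 0 := by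
    ext a b; by_cases h : i = j <;> simp [Q3, h]
  have k (i : Fin (r + 1)) : ∑ j, w i ⬝ᵥ (Matrix.of fun a b => Q3 s A0 Bq Cp Dpq P S M Δ
      (Sum.inr ⟨i, a⟩) (Sum.inr ⟨j, b⟩)) *ᵥ w j =
      w i ⬝ᵥ (-(M i) + (Dpq i * Δ i)ᵀ * M i * (Dpq i * Δ i)) *ᵥ w i := by
    rw [Finset.sum_eq_single i]
    · congr 2
      ext a b; simp [Q3]
    · intro j _ hj
      have : (Matrix.of fun a b => Q3 s A0 Bq Cp Dpq P S M Δ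
          (Sum.inr ⟨i, a⟩) (Sum.inr ⟨j, b⟩)) = 0 := by
        ext a b; simp [Q3, hj]
      simp [this]
    · simp
  have hite {α β : Type} [Fintype α] [Fintype β] (c : Prop) [Decidable c] (N : Matrix α β ℝ)
      (u : α → ℝ) (u' : β → ℝ) :
      u ⬝ᵥ (if c then N else 0) *ᵥ u' = if c then u ⬝ᵥ N *ᵥ u' else 0 := by
    split_ifs <;> simp
  rw [dotProduct_mulVec_sum_blocks]
  simp only [hT]
  rw [Finset.sum_comm (f := fun i j => y j ⬝ᵥ (Matrix.of fun a b =>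
        Q3 s A0 Bq Cp Dpq P S M Δ (Sum.inl (j, a)) (Sum.inr ⟨i, b⟩)) *ᵥ w i)]
  simp only [k]
  simp only [Fin.sum_univ_succ, h00, h0s, hs0, hss, g00, g0s, gs0, gss, hite, Finset.sum_ite_eq,
    Finset.mem_univ, if_true, zero_mulVec, dotProduct_zero, zero_add]
  simp only [channelForm, mulVec_add, add_mulVec, sub_mulVec, neg_mulVec, sum_mulVec, mulVec_sum,
    dotProduct_add, dotProduct_sub, dotProduct_neg, dotProduct_sum, add_dotProduct,
    transpose_mul, ← mulVec_mulVec, Finset.sum_add_distrib, Finset.sum_sub_distrib,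
    Finset.sum_neg_distrib]
  simp only [dotProduct_transpose_mulVec]
  have hP' (u z : Fin n → ℝ) : P *ᵥ u ⬝ᵥ z = u ⬝ᵥ P *ᵥ z := by
    rw [dotProduct_comm, dotProduct_mulVec_comm_of_isSymm hPsym]
  have hD (i) (u z : DIdx s i → ℝ) : (Dpq i)ᵀ *ᵥ u ⬝ᵥ z = u ⬝ᵥ Dpq i *ᵥ z := by
    rw [dotProduct_comm, dotProduct_transpose_mulVec]
  have hM' (i) (u z : DIdx s i → ℝ) : M i *ᵥ u ⬝ᵥ z = z ⬝ᵥ M i *ᵥ u := dotProduct_comm _ _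
  have hDC (i) (u : DIdx s i → ℝ) (z : Fin n → ℝ) :
      Dpq i *ᵥ u ⬝ᵥ M i *ᵥ Cp i *ᵥ z = Cp i *ᵥ z ⬝ᵥ M i *ᵥ Dpq i *ᵥ u :=
    dotProduct_mulVec_comm_of_isSymm (hMsym i) _ _
  simp only [hPsym, hP', hD, hM', hDC, ← Finset.mul_sum]
  ring

variable {s A0 Bq Cp Dpq P S M}

theorem convexOn_channelForm (hM : ∀ i, (M i).PosDef) (y : Fin (r + 1) → Fin n → ℝ)
    (i : Fin (r + 1)) (w : DIdx s i → ℝ) :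
    ConvexOn ℝ Set.univ fun θ => channelForm s Bq Cp Dpq P M y i w (Delta s i θ) := by
  refine ⟨convex_univ, fun θ _ θ' _ a b ha hb hab => ?_⟩
  have hΔ : Delta s i (a • θ + b • θ') *ᵥ w = a • Delta s i θ *ᵥ w + b • Delta s i θ' *ᵥ w := by
    ext p
    simp [Delta, mulVec_diagonal]
    ring
  have hC : Cp i *ᵥ y i + Dpq i *ᵥ Delta s i (a • θ + b • θ') *ᵥ w =
      a • (Cp i *ᵥ y i + Dpq i *ᵥ Delta s i θ *ᵥ w) +
        b • (Cp i *ᵥ y i + Dpq i *ᵥ Delta s i θ' *ᵥ w) := by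
    rw [hΔ, mulVec_add, mulVec_smul, mulVec_smul]
    nth_rewrite 1 [← one_smul ℝ (Cp i *ᵥ y i), ← hab]
    module
  have hq := (hM i).convexOn_dotProduct_mulVec.2
    (Set.mem_univ (Cp i *ᵥ y i + Dpq i *ᵥ Delta s i θ *ᵥ w))
    (Set.mem_univ (Cp i *ᵥ y i + Dpq i *ᵥ Delta s i θ' *ᵥ w)) ha hb hab
  simp only [channelForm, hC]
  simp only [hΔ, mulVec_add, mulVec_smul, dotProduct_add, dotProduct_smul, smul_eq_mul] at hq ⊢
  linarith

/-- The vertex conditions imply a uniform dissipation inequality on the whole polytope. -/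
theorem exists_dissipation {v : ℕ} (hv : 1 ≤ v) {θvert : Fin v → Fin m → ℝ}
    (hwell : ∀ θ ∈ convexHull ℝ (Set.range θvert), ∀ i, (1 - Dpq i * Delta s i θ).det ≠ 0)
    (hPsym : Pᵀ = P) (hMsym : ∀ i, (M i)ᵀ = M i) (hM : ∀ i, (M i).PosDef)
    (hQ : ∀ k : Fin (r + 1) → Fin v,
      (-(Q3 s A0 Bq Cp Dpq P S M fun i => Delta s i (θvert (k i)))).PosDef) :
    ∃ ε > 0, ∀ θ ∈ convexHull ℝ (Set.range θvert), ∀ y : Fin (r + 1) → Fin n → ℝ,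
      2 * (y 0 ⬝ᵥ P *ᵥ ∑ i, Amat s A0 Bq Cp Dpq i θ *ᵥ y i) + ∑ l, y 0 ⬝ᵥ S l *ᵥ y 0 -
        ∑ l : Fin r, y l.succ ⬝ᵥ S l *ᵥ y l.succ ≤ -(ε * ‖y 0‖ ^ 2) := by
  choose ε hε hεQ using fun k => (hQ k).exists_mul_sq_norm_le
  have : Nonempty (Fin v) := ⟨⟨0, hv⟩⟩
  obtain ⟨k₀, hk₀⟩ := Finite.exists_min ε
  refine ⟨ε k₀, hε k₀, fun θ hθ y => ?_⟩
  let w : (i : Fin (r + 1)) → DIdx s i → ℝ := fun i =>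
    (1 - Dpq i * Delta s i θ)⁻¹ *ᵥ Cp i *ᵥ y i
  have hw (i) : Cp i *ᵥ y i + Dpq i *ᵥ Delta s i θ *ᵥ w i = w i := by
    have h : (1 - Dpq i * Delta s i θ) *ᵥ w i = Cp i *ᵥ y i := by
      simp only [w, mulVec_mulVec]
      rw [← Matrix.mul_assoc, mul_nonsing_inv _ (hwell θ hθ i).isUnit, Matrix.one_mul]
    rw [sub_mulVec, one_mulVec, ← mulVec_mulVec] at h
    rw [← h, sub_add_cancel]
  choose k hk using fun i => show ∃ k : Fin v,
      channelForm s Bq Cp Dpq P M y i (w i) (Delta s i θ) ≤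
        channelForm s Bq Cp Dpq P M y i (w i) (Delta s i (θvert k)) by
    obtain ⟨_, ⟨k, rfl⟩, hk⟩ := (convexOn_channelForm (Bq := Bq) (Cp := Cp) (Dpq := Dpq) (P := P)
      hM y i (w i)).exists_ge_of_mem_convexHull (Set.subset_univ _) hθ
    exact ⟨k, hk⟩
  let z : (Fin (r + 1) × Fin n) ⊕ ((i : Fin (r + 1)) × DIdx s i) → ℝ :=
    Sum.elim (fun p => y p.1 p.2) fun p => w p.1 p.2
  have hz : ‖y 0‖ ≤ ‖z‖ := (pi_norm_le_iff_of_nonneg (norm_nonneg z)).2 fun a =>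
    norm_le_pi_norm z (Sum.inl (0, a))
  have hform := hεQ k z
  rw [neg_mulVec, dotProduct_neg, dotProduct_Q3_mulVec s A0 Bq Cp Dpq P S M hPsym hMsym] at hform
  have hmono : ε k₀ * ‖y 0‖ ^ 2 ≤ ε k * ‖z‖ ^ 2 := by
    gcongr
    · exact (hε k).le
    · exact hk₀ k
  have hchan : ∑ i, 2 * (y 0 ⬝ᵥ P *ᵥ Bq i *ᵥ Delta s i θ *ᵥ w i) ≤
      ∑ i, (channelForm s Bq Cp Dpq P M y i (w i) (Delta s i (θvert (k i))) -
        w i ⬝ᵥ M i *ᵥ w i) := by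
    refine Finset.sum_le_sum fun i _ => ?_
    have := hk i
    rw [channelForm, hw i] at this
    linarith
  have hA : 2 * (y 0 ⬝ᵥ P *ᵥ ∑ i, Amat s A0 Bq Cp Dpq i θ *ᵥ y i) =
      2 * (y 0 ⬝ᵥ P *ᵥ ∑ i, A0 i *ᵥ y i) +
        ∑ i, 2 * (y 0 ⬝ᵥ P *ᵥ Bq i *ᵥ Delta s i θ *ᵥ w i) := by
    simp only [Amat, w, add_mulVec, ← mulVec_mulVec, Finset.sum_add_distrib, mulVec_add,
      dotProduct_add, mulVec_sum, dotProduct_sum, ← Finset.mul_sum]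
    ring
  linarith
end

theorem HasDerivAt.dotProduct {ι : Type*} [Fintype ι] {f g : ℝ → ι → ℝ} {f' g' : ι → ℝ} {t : ℝ}
    (hf : HasDerivAt f f' t) (hg : HasDerivAt g g' t) :
    HasDerivAt (fun t => f t ⬝ᵥ g t) (f' ⬝ᵥ g t + f t ⬝ᵥ g') t := by
  simp only [_root_.dotProduct, ← Finset.sum_add_distrib]
  exact HasDerivAt.fun_sum fun i _ => (hasDerivAt_pi.1 hf i).mul (hasDerivAt_pi.1 hg i)

theorem HasDerivAt.mulVec {ι κ : Type*} [Fintype ι] [Fintype κ] (N : Matrix κ ι ℝ)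
    {f : ℝ → ι → ℝ} {f' : ι → ℝ} {t : ℝ} (hf : HasDerivAt f f' t) :
    HasDerivAt (fun t => N *ᵥ f t) (N *ᵥ f') t :=
  (mulVecLin N).toContinuousLinearMap.hasFDerivAt.comp_hasDerivAt t hf

/-- A Barbalat-type lemma: a nonnegative function whose derivative is bounded above and which
dominates the decay rate of a function bounded below tends to zero. -/
theorem tendsto_zero_of_deriv_le_neg_mul {u u' V V' : ℝ → ℝ} {c C : ℝ} (hc : 0 < c)
    (hu₀ : ∀ t > 0, 0 ≤ u t) (hV₀ : ∀ t > 0, 0 ≤ V t)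
    (hu : ∀ t > 0, HasDerivAt u (u' t) t) (hV : ∀ t > 0, HasDerivAt V (V' t) t)
    (huC : ∀ t > 0, u' t ≤ C) (hVc : ∀ t > 0, V' t ≤ -(c * u t)) :
    Tendsto u atTop (nhds 0) := by
  have hanti : AntitoneOn V (Set.Ioi 0) := by
    refine antitoneOn_of_deriv_nonpos (convex_Ioi 0)
      (fun t ht => (hV t ht).continuousAt.continuousWithinAt)
      (fun t ht => (hV t (interior_subset ht)).differentiableAt.differentiableWithinAt) ?_
    intro t ht
    rw [(hV t (interior_subset ht)).deriv]
    nlinarith [hVc t (interior_subset ht), hu₀ t (interior_subset ht)]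
  rw [Metric.tendsto_atTop]
  intro δ hδ
  set K := max C 1
  have hK : 0 < K := by positivity
  set τ := δ / (2 * K) with hτdef
  have hτ : 0 < τ := by positivity
  have hbdd : BddBelow (V '' Set.Ioi 0) := ⟨0, by
    rintro _ ⟨t, ht, rfl⟩
    exact hV₀ t ht⟩
  obtain ⟨_, ⟨T, hT, rfl⟩, hVT⟩ := exists_lt_of_csInf_lt (s := V '' Set.Ioi 0)
    (Set.Nonempty.image _ ⟨1, Set.mem_Ioi.2 one_pos⟩)
    (lt_add_of_pos_right _ (show 0 < c * (δ / 2) * τ by positivity))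
  rw [Set.mem_Ioi] at hT
  refine ⟨T + τ, fun t ht => ?_⟩
  have htpos : 0 < t := by linarith
  rw [Real.dist_eq, sub_zero, abs_of_nonneg (hu₀ t htpos)]
  by_contra! hut
  have hpos {q : ℝ} (hq : q ∈ Set.Icc (t - τ) t) : 0 < q := by linarith [hq.1]
  have hlow (q : ℝ) (hq : q ∈ Set.Icc (t - τ) t) : δ / 2 ≤ u q := by
    have hpos' {q' : ℝ} (hq' : q' ∈ Set.Icc q t) : 0 < q' := by linarith [hpos hq, hq'.1]
    have h := (convex_Icc q t).image_sub_le_mul_sub_of_deriv_le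
      (fun y hy => (hu y (hpos' hy)).continuousAt.continuousWithinAt)
      (fun y hy => (hu y (hpos' (interior_subset hy))).differentiableAt.differentiableWithinAt)
      (C := K) (fun y hy => by
        rw [(hu y (hpos' (interior_subset hy))).deriv]
        exact (huC y (hpos' (interior_subset hy))).trans (le_max_left _ _))
      q ⟨le_rfl, hq.2⟩ t ⟨hq.2, le_rfl⟩ hq.2
    have h2 : K * (t - q) ≤ K * τ := by
      gcongr
      linarith [hq.1]
    have h3 : K * τ = δ / 2 := by
      rw [hτdef]
      field_simp
    linarith
  have h := (convex_Icc (t - τ) t).image_sub_le_mul_sub_of_deriv_le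
    (fun y hy => (hV y (hpos hy)).continuousAt.continuousWithinAt)
    (fun y hy => (hV y (hpos (interior_subset hy))).differentiableAt.differentiableWithinAt)
    (C := -(c * (δ / 2))) (fun y hy => by
      rw [(hV y (hpos (interior_subset hy))).deriv]
      have := mul_le_mul_of_nonneg_left (hlow y (interior_subset hy)) hc.le
      linarith [hVc y (hpos (interior_subset hy))])
    (t - τ) ⟨le_rfl, by linarith⟩ t ⟨by linarith, le_rfl⟩ (by linarith)
  have h1 : V (t - τ) ≤ V T :=
    hanti hT (Set.mem_Ioi.2 (by linarith)) (by linarith)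
  have h2 : sInf (V '' Set.Ioi 0) ≤ V t := csInf_le hbdd ⟨t, htpos, rfl⟩
  linarith

/-- A Lyapunov–Krasovskii criterion: a trajectory that dissipates the functional
`x(t)ᵀ P x(t) + ∑ₗ ∫_{t-τₗ}^t x(q)ᵀ Sₗ x(q) dq` is bounded and tends to zero. -/
theorem bounded_and_tendsto_zero_of_dissipation {n r : ℕ} {P : Matrix (Fin n) (Fin n) ℝ}
    (hPsym : Pᵀ = P) (hP : P.PosDef) {S : Fin r → Matrix (Fin n) (Fin n) ℝ}
    (hS : ∀ l, (S l).PosDef) {τ : Fin r → ℝ} (hτ : ∀ l, 0 ≤ τ l) {H : ℝ} (hH : ∀ l, τ l ≤ H)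
    {x x' : ℝ → Fin n → ℝ} (hx : Continuous x) (hx' : ∀ t > 0, HasDerivAt x (x' t) t)
    {ε : ℝ} (hε : 0 < ε)
    (hdiss : ∀ t > 0, 2 * (x t ⬝ᵥ P *ᵥ x' t) + ∑ l, x t ⬝ᵥ S l *ᵥ x t -
      ∑ l, x (t - τ l) ⬝ᵥ S l *ᵥ x (t - τ l) ≤ -(ε * ‖x t‖ ^ 2)) :
    (∃ C, ∀ t ≥ -H, ‖x t‖ ≤ C) ∧ Tendsto x atTop (nhds 0) := by
  have hnn {N : Matrix (Fin n) (Fin n) ℝ} (hN : N.PosDef) (z : Fin n → ℝ) :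
      0 ≤ z ⬝ᵥ N *ᵥ z := by
    simpa using hN.posSemidef.dotProduct_mulVec_nonneg z
  set u : ℝ → ℝ := fun t => x t ⬝ᵥ P *ᵥ x t with hu_def
  set g : Fin r → ℝ → ℝ := fun l t => x t ⬝ᵥ S l *ᵥ x t with hg_def
  have hg (l) : Continuous (g l) := by fun_prop
  set G : Fin r → ℝ → ℝ := fun l t => ∫ q in (0 : ℝ)..t, g l q with hG_def
  have hG (l t) : HasDerivAt (G l) (g l t) t := ((hg l).integral_hasStrictDerivAt 0 t).hasDerivAt
  have hGmono (l) : Monotone (G l) :=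
    monotone_of_deriv_nonneg (fun t => (hG l t).differentiableAt) fun t => by
      rw [(hG l t).deriv]
      exact hnn (hS l) _
  set V : ℝ → ℝ := fun t => u t + ∑ l, (G l t - G l (t - τ l)) with hV_def
  have huV (t) : u t ≤ V t := by
    have : 0 ≤ ∑ l, (G l t - G l (t - τ l)) := Finset.sum_nonneg fun l _ =>
      sub_nonneg.2 (hGmono l (by linarith [hτ l]))
    simp only [hV_def]
    linarith
  have hu' (t) (ht : t > 0) : HasDerivAt u (2 * (x t ⬝ᵥ P *ᵥ x' t)) t := by
    refine ((hx' t ht).dotProduct ((hx' t ht).mulVec P)).congr_deriv ?_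
    rw [dotProduct_mulVec_comm_of_isSymm hPsym (x' t)]
    ring
  have hV' (t) (ht : t > 0) : HasDerivAt V
      (2 * (x t ⬝ᵥ P *ᵥ x' t) + ∑ l, (g l t - g l (t - τ l))) t :=
    (hu' t ht).add (HasDerivAt.fun_sum fun l _ =>
      (hG l t).sub ((hG l (t - τ l)).comp_sub_const t (τ l)))
  have hV'le (t) (ht : t > 0) :
      2 * (x t ⬝ᵥ P *ᵥ x' t) + ∑ l, (g l t - g l (t - τ l)) ≤ -(ε * ‖x t‖ ^ 2) := by
    rw [Finset.sum_sub_distrib]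
    linarith [hdiss t ht]
  have hVcont : Continuous V := by
    have hGc (l) : Continuous (G l) :=
      continuous_iff_continuousAt.2 fun t => (hG l t).continuousAt
    fun_prop
  have hanti : AntitoneOn V (Set.Ici 0) := by
    refine antitoneOn_of_deriv_nonpos (convex_Ici 0) hVcont.continuousOn ?_ ?_ <;>
      rw [interior_Ici]
    · exact fun t ht => (hV' t ht).differentiableAt.differentiableWithinAt
    · intro t ht
      rw [(hV' t ht).deriv]
      nlinarith [hV'le t ht, sq_nonneg ‖x t‖]
  obtain ⟨a, ha, haP⟩ := hP.exists_mul_sq_norm_le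
  obtain ⟨b, hb, hbP⟩ := P.exists_dotProduct_mulVec_le
  obtain ⟨C₀, hC₀⟩ := (isCompact_Icc (a := -H) (b := 0)).bddAbove_image hx.norm.continuousOn
  have hbound : ∃ C, ∀ t ≥ -H, ‖x t‖ ≤ C := by
    refine ⟨max C₀ √(V 0 / a), fun t ht => ?_⟩
    rcases le_total t 0 with h0 | h0
    · exact (hC₀ ⟨t, ⟨ht, h0⟩, rfl⟩).trans (le_max_left _ _)
    · refine le_trans (Real.le_sqrt_of_sq_le ?_) (le_max_right _ _)
      rw [le_div_iff₀ ha, mul_comm]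
      exact (haP _).trans ((huV t).trans (hanti Set.self_mem_Ici h0 h0))
  refine ⟨hbound, ?_⟩
  obtain ⟨C, hC⟩ := hbound
  choose K hK hKS using fun l => (S l).exists_dotProduct_mulVec_le
  have hu0 : Tendsto u atTop (nhds 0) := by
    refine tendsto_zero_of_deriv_le_neg_mul (c := ε / b) (C := ∑ l, K l * C ^ 2) (by positivity)
      (fun t _ => hnn hP _) (fun t _ => (hnn hP _).trans (huV t)) hu' hV' ?_ ?_
    · intro t ht
      have h1 : ∑ l, x (t - τ l) ⬝ᵥ S l *ᵥ x (t - τ l) ≤ ∑ l, K l * C ^ 2 := by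
        refine Finset.sum_le_sum fun l _ => (hKS l _).trans ?_
        have := hK l
        gcongr
        exact hC _ (by linarith [hH l])
      have h2 : 0 ≤ ∑ l, x t ⬝ᵥ S l *ᵥ x t := Finset.sum_nonneg fun l _ => hnn (hS l) _
      have h3 : 0 ≤ ε * ‖x t‖ ^ 2 := by positivity
      linarith [hdiss t ht]
    · intro t ht
      refine (hV'le t ht).trans (neg_le_neg ?_)
      calc ε / b * u t ≤ ε / b * (b * ‖x t‖ ^ 2) := by
            gcongr
            exact hbP _
        _ = ε * ‖x t‖ ^ 2 := by field_simp
  have hsq : Tendsto (fun t => √(u t / a)) atTop (nhds 0) := by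
    simpa using (hu0.div_const a).sqrt
  refine squeeze_zero_norm (fun t => Real.le_sqrt_of_sq_le ?_) hsq
  rw [le_div_iff₀ ha, mul_comm]
  exact haP _

/-- **Corollary 3 (delay-independent stability via vertex tests).**
If there exist `P = Pᵀ > 0`, `Sᵢ = Sᵢᵀ > 0` and multipliers `Mᵢ = Mᵢᵀ > 0` such that
`Q⁽³⁾(k₀,…,k_r) < 0` at every tuple of vertices of `Θ`, then the unforced delayed system is
globally asymptotically stable independent of the delays. -/
theorem corollary3_vertex_delay_independent_stability
    (n r m : ℕ) (hn : 1 ≤ n) (hr : 1 ≤ r) (hm : 1 ≤ m)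
    (v : ℕ) (hv : 1 ≤ v) (θvert : Fin v → Fin m → ℝ)
    (Θ : Set (Fin m → ℝ)) (hΘ : Θ = convexHull ℝ (Set.range θvert))
    (hΘ0 : (0 : Fin m → ℝ) ∈ Θ)
    (s : Fin (r + 1) → Fin m → ℕ)
    (A0 : Fin (r + 1) → Matrix (Fin n) (Fin n) ℝ)
    (Bq : (i : Fin (r + 1)) → Matrix (Fin n) (DIdx s i) ℝ)
    (Cp : (i : Fin (r + 1)) → Matrix (DIdx s i) (Fin n) ℝ)
    (Dpq : (i : Fin (r + 1)) → Matrix (DIdx s i) (DIdx s i) ℝ)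
    (hwell : ∀ θ ∈ Θ, ∀ i, (1 - Dpq i * Delta s i θ).det ≠ 0)
    (P : Matrix (Fin n) (Fin n) ℝ) (hPsym : Pᵀ = P) (hP : P.PosDef)
    (S : Fin r → Matrix (Fin n) (Fin n) ℝ)
    (hSsym : ∀ i, (S i)ᵀ = S i) (hS : ∀ i, (S i).PosDef)
    (M : (i : Fin (r + 1)) → Matrix (DIdx s i) (DIdx s i) ℝ)
    (hMsym : ∀ i, (M i)ᵀ = M i) (hM : ∀ i, (M i).PosDef)
    (hQ : ∀ k : Fin (r + 1) → Fin v,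
      (-(Q3 s A0 Bq Cp Dpq P S M fun i => Delta s i (θvert (k i)))).PosDef) :
    ∀ hdel : Fin (r + 1) → ℝ, hdel 0 = 0 → (∀ i, 0 ≤ hdel i) →
      ∀ θ : ℝ → Fin m → ℝ, Continuous θ → (∀ t ≥ (0 : ℝ), θ t ∈ Θ) →
        ∀ x : ℝ → Fin n → ℝ,
          ContinuousOn x (Set.Ici (-(⨆ i, hdel i))) →
          (∀ t > (0 : ℝ), HasDerivAt x
            (∑ i, (Amat s A0 Bq Cp Dpq i (θ t)).mulVec (x (t - hdel i))) t) →
          (∃ C : ℝ, ∀ t ≥ -(⨆ i, hdel i), ‖x t‖ ≤ C) ∧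
            Tendsto x atTop (nhds 0) := by
  intro hdel h0 hnn θ _ hθ x hx hx'
  subst hΘ
  obtain ⟨ε, hε, hdiss⟩ := exists_dissipation (A0 := A0) (Bq := Bq) (S := S) hv hwell hPsym hMsym
    hM hQ
  set H := ⨆ i, hdel i
  have hH (i) : hdel i ≤ H := le_ciSup (Set.finite_range hdel).bddAbove i
  have hH0 : 0 ≤ H := (hnn 0).trans (hH 0)
  let x₁ : ℝ → Fin n → ℝ := fun t => x (max t (-H))
  have hx₁ {t : ℝ} (ht : -H ≤ t) : x₁ t = x t := by simp only [x₁, max_eq_left ht]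
  have hx₁c : Continuous x₁ :=
    hx.comp_continuous (by fun_prop) fun t => Set.mem_Ici.2 (le_max_right _ _)
  have hx₁' (t : ℝ) (ht : t > 0) : HasDerivAt x₁
      (∑ i, (Amat s A0 Bq Cp Dpq i (θ t)).mulVec (x (t - hdel i))) t :=
    (hx' t ht).congr_of_eventuallyEq <| by
      filter_upwards [lt_mem_nhds ht] with q hq
      exact hx₁ (by linarith)
  obtain ⟨⟨C, hC⟩, hlim⟩ := bounded_and_tendsto_zero_of_dissipation hPsym hP hS
    (fun l => hnn l.succ) (fun l => hH l.succ) hx₁c hx₁' hε fun t ht => by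
      have h := hdiss (θ t) (hθ t ht.le) fun i => x (t - hdel i)
      have hsucc (l : Fin r) : x₁ (t - hdel l.succ) = x (t - hdel l.succ) :=
        hx₁ (by linarith [hH l.succ])
      simp only [h0, sub_zero] at h
      simpa only [hsucc, hx₁ (show -H ≤ t by linarith)] using h
  refine ⟨⟨C, fun t ht => hx₁ ht ▸ hC t ht⟩, hlim.congr' ?_⟩
  filter_upwards [eventually_ge_atTop (-H)] with t ht
  exact hx₁ ht
end

section
/- Lyapunov matrix inequality implies strict Hurwitz property. Let A be a real n×n matrix and suppose there exists a real symmetric positive definite matrix P = Pᵀ > 0 such that AᵀP + PA is negative definite. Then A is strictly Hurwitzian: every eigenvalue of A, regarded as a complex matrix, has strictly negative real part. -/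
open Matrix

lemma Matrix.dotProduct_lyapunov_mulVec {ι : Type*} [Fintype ι] {A P : Matrix ι ι ℝ}
    (hP : Pᵀ = P) (x : ι → ℝ) :
    x ⬝ᵥ (Aᵀ * P + P * A) *ᵥ x = 2 * (x ⬝ᵥ P *ᵥ (A *ᵥ x)) := by
  have h : x ⬝ᵥ Aᵀ *ᵥ (P *ᵥ x) = x ⬝ᵥ P *ᵥ (A *ᵥ x) := by
    rw [dotProduct_mulVec, vecMul_transpose, dotProduct_mulVec, ← mulVec_transpose, hP,
      dotProduct_comm]
  rw [add_mulVec, dotProduct_add, ← mulVec_mulVec, ← mulVec_mulVec, h, two_mul]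

/-- A complex eigenvector of a real matrix, split into its real and imaginary parts. -/
lemma Matrix.exists_real_imaginary_of_mem_spectrum {ι : Type*} [Fintype ι] [DecidableEq ι]
    {A : Matrix ι ι ℝ} {μ : ℂ} (hμ : μ ∈ spectrum ℂ (A.map (Complex.ofReal ·))) :
    ∃ x y : ι → ℝ, (x ≠ 0 ∨ y ≠ 0) ∧ A *ᵥ x = μ.re • x - μ.im • y ∧
      A *ᵥ y = μ.im • x + μ.re • y := by
  rw [← spectrum_toLin', ← Module.End.hasEigenvalue_iff_mem_spectrum] at hμ
  obtain ⟨v, hv⟩ := hμ.exists_hasEigenvector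
  have hAv := hv.apply_eq_smul
  rw [toLin'_apply] at hAv
  refine ⟨fun i => (v i).re, fun i => (v i).im, ?_, ?_, ?_⟩
  · by_contra! h
    exact hv.2 (funext fun i => Complex.ext (congrFun h.1 i) (congrFun h.2 i))
  · ext i
    simpa [mulVec, dotProduct] using congrArg Complex.re (congrFun hAv i)
  · ext i
    simpa [mulVec, dotProduct, add_comm] using congrArg Complex.im (congrFun hAv i)

/-- **Lyapunov matrix inequality implies the strict Hurwitz property.**
If `P = Pᵀ > 0` and `AᵀP + PA < 0`, then every eigenvalue of `A` (as a complex matrix)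
has strictly negative real part. -/
theorem lyapunov_implies_hurwitz (n : ℕ) (hn : 1 ≤ n)
    (A P : Matrix (Fin n) (Fin n) ℝ)
    (hPsym : Pᵀ = P) (hP : P.PosDef)
    (hLyap : (-(Aᵀ * P + P * A)).PosDef) :
    ∀ μ ∈ spectrum ℂ (A.map (Complex.ofReal ·)), μ.re < 0 := by
  intro μ hμ
  obtain ⟨x, y, hxy, hx, hy⟩ := exists_real_imaginary_of_mem_spectrum hμ
  have hsymm : y ⬝ᵥ P *ᵥ x = x ⬝ᵥ P *ᵥ y := by
    rw [dotProduct_mulVec, ← mulVec_transpose, hPsym, dotProduct_comm]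
  have hsum : x ⬝ᵥ (-(Aᵀ * P + P * A)) *ᵥ x + y ⬝ᵥ (-(Aᵀ * P + P * A)) *ᵥ y =
      -(2 * μ.re * (x ⬝ᵥ P *ᵥ x + y ⬝ᵥ P *ᵥ y)) := by
    rw [neg_mulVec, neg_mulVec, dotProduct_neg, dotProduct_neg,
      dotProduct_lyapunov_mulVec hPsym, dotProduct_lyapunov_mulVec hPsym, hx, hy]
    simp only [mulVec_sub, mulVec_add, mulVec_smul, dotProduct_sub, dotProduct_add,
      dotProduct_smul, smul_eq_mul, hsymm]
    ring
  have hpos : ∀ M : Matrix (Fin n) (Fin n) ℝ, M.PosDef →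
      0 < x ⬝ᵥ M *ᵥ x + y ⬝ᵥ M *ᵥ y := by
    intro M hM
    have hnonneg (z : Fin n → ℝ) : 0 ≤ z ⬝ᵥ M *ᵥ z := by
      simpa using hM.posSemidef.dotProduct_mulVec_nonneg z
    rcases hxy with h | h
    · exact add_pos_of_pos_of_nonneg (by simpa using hM.dotProduct_mulVec_pos h) (hnonneg y)
    · exact add_pos_of_nonneg_of_pos (hnonneg x) (by simpa using hM.dotProduct_mulVec_pos h)
  have hL := hpos _ hLyap
  rw [hsum] at hL
  by_contra! h
  linarith [mul_nonneg h (hpos P hP).le]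
end

section
/- Necessity of Hurwitz matrices for stability independent of the delays. Let A_{00}, A_{01},…,A_{0r} be real n×n matrices. Suppose that for every choice of delays h_i ≥ 0 (i = 1,…,r; h_0 = 0, h = max_i h_i), every solution of the nominal delayed system is bounded and tends to zero as t → ∞. Then both A_{00} and Σ_{i=0}^r A_{0i} are stability matrices, i.e., all of their eigenvalues, regarded as complex matrices, have strictly negative real part. -/
open Matrix Filter

/-- **Hurwitz's theorem** for a family of entire functions: if `f k` tends to `f₀` along `l`,
locally uniformly near a zero `z₀` of `f₀`, and `f₀` is not identically zero, then every
neighbourhood of `z₀` eventually contains a zero of `f k`. -/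
theorem eventually_exists_zero_mem_ball {ι : Type*} {l : Filter ι} {f : ι → ℂ → ℂ} {f₀ : ℂ → ℂ}
    {z₀ : ℂ} (hf : ∀ k, Differentiable ℂ (f k)) (hf₀ : Differentiable ℂ f₀) (hz₀ : f₀ z₀ = 0)
    (hne : ∃ w, f₀ w ≠ 0)
    (hlim : ∀ᶠ z in nhds z₀, Tendsto (fun q : ι × ℂ => f q.1 q.2) (l ×ˢ nhds z) (nhds (f₀ z)))
    {R : ℝ} (hR : 0 < R) :
    ∀ᶠ k in l, ∃ z ∈ Metric.ball z₀ R, f k z = 0 := by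
  have hiso : ∀ᶠ z in nhdsWithin z₀ {z₀}ᶜ, f₀ z ≠ 0 := by
    refine (hf₀.analyticAt z₀).eventually_eq_zero_or_eventually_ne_zero.resolve_left fun h => ?_
    obtain ⟨w, hw⟩ := hne
    have hanal : AnalyticOnNhd ℂ f₀ Set.univ := fun z _ => hf₀.analyticAt z
    exact hw (hanal.eqOn_zero_of_preconnected_of_eventuallyEq_zero isPreconnected_univ
      (Set.mem_univ z₀) h (Set.mem_univ w))
  rw [eventually_nhdsWithin_iff] at hiso
  obtain ⟨ε, hε, hball⟩ := Metric.eventually_nhds_iff.1 (hiso.and hlim)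
  set ρ := min ε R / 2 with hρ
  have hmin : 0 < min ε R := lt_min hε hR
  have hρ0 : 0 < ρ := by positivity
  have hρε : ρ < ε := by linarith [min_le_left ε R]
  have hρR : ρ < R := by linarith [min_le_right ε R]
  have hK : IsCompact (Metric.sphere z₀ ρ) := isCompact_sphere z₀ ρ
  have hsphere : ∀ z ∈ Metric.sphere z₀ ρ, f₀ z ≠ 0 := fun z hz => by
    have hz' : dist z z₀ = ρ := hz
    refine (hball (hz'.trans_lt hρε)).1 fun h => ?_
    rw [Set.mem_singleton_iff.1 h, dist_self] at hz'
    exact hρ0.ne hz'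
  obtain ⟨w, hw, hwmin⟩ := hK.exists_isMinOn (NormedSpace.sphere_nonempty.2 hρ0.le)
    hf₀.continuous.norm.continuousOn
  have hm : 0 < ‖f₀ w‖ := norm_pos_iff.2 (hsphere w hw)
  have hlarge : ∀ᶠ k in l, ∀ z ∈ Metric.sphere z₀ ρ, ‖f₀ w‖ / 2 < ‖f k z‖ := by
    have : ∀ᶠ q : ι × ℂ in l ×ˢ nhdsSet (Metric.sphere z₀ ρ), ‖f₀ w‖ / 2 < ‖f q.1 q.2‖ := by
      refine hK.mem_prod_nhdsSet_of_forall fun z hz => ?_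
      have hz' : dist z z₀ = ρ := hz
      refine (hball (hz'.trans_lt hρε)).2.norm.eventually (lt_mem_nhds ?_)
      have : ‖f₀ w‖ ≤ ‖f₀ z‖ := hwmin hz
      linarith
    exact this.curry.mono fun _ h => h.self_of_nhdsSet
  have hsmall : ∀ᶠ k in l, ‖f k z₀‖ < ‖f₀ w‖ / 2 := by
    have h := (hball (y := z₀) (by simpa using hε)).2.norm.eventually
      (gt_mem_nhds (show ‖f₀ z₀‖ < ‖f₀ w‖ / 2 by rw [hz₀, norm_zero]; positivity))
    exact h.curry.mono fun _ h => h.self_of_nhds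
  filter_upwards [hlarge, hsmall] with k hk₁ hk₂
  by_contra! hk
  have hnz : ∀ z ∈ Metric.closedBall z₀ ρ, f k z ≠ 0 := fun z hz =>
    hk z (Metric.closedBall_subset_ball hρR hz)
  have hd : DiffContOnCl ℂ (fun z => (f k z)⁻¹) (Metric.ball z₀ ρ) := by
    refine DifferentiableOn.diffContOnCl ?_
    rw [closure_ball z₀ hρ0.ne']
    exact fun z hz => ((hf k z).inv (hnz z hz)).differentiableWithinAt
  have hmax := Complex.norm_le_of_forall_mem_frontier_norm_le (C := (‖f₀ w‖ / 2)⁻¹)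
    Metric.isBounded_ball hd (fun z hz => by
      rw [frontier_ball z₀ hρ0.ne'] at hz
      rw [norm_inv]
      exact inv_anti₀ (by positivity) (hk₁ z hz).le)
    (subset_closure (Metric.mem_ball_self hρ0))
  rw [norm_inv] at hmax
  have hpos : 0 < ‖f k z₀‖ := norm_pos_iff.2 (hnz z₀ (Metric.mem_closedBall_self hρ0.le))
  exact absurd ((inv_le_inv₀ hpos (by positivity)).1 hmax) (not_le.2 hk₂)

/-- The bivariate characteristic function `det (s I - (A + z B))`. -/
noncomputable def delayCharDet {n : ℕ} (A B : Matrix (Fin n) (Fin n) ℂ) (s z : ℂ) : ℂ :=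
  (s • (1 : Matrix (Fin n) (Fin n) ℂ) - (A + z • B)).det

section delayCharDet

variable {n : ℕ} (A B : Matrix (Fin n) (Fin n) ℂ)

theorem continuous_delayCharDet : Continuous fun p : ℂ × ℂ => delayCharDet A B p.1 p.2 := by
  unfold delayCharDet
  fun_prop

variable {A B} in
theorem tendsto_delayCharDet {ι : Type*} {l : Filter ι} {u v : ι → ℂ} {a b : ℂ}
    (hu : Tendsto u l (nhds a)) (hv : Tendsto v l (nhds b)) :
    Tendsto (fun q => delayCharDet A B (u q) (v q)) l (nhds (delayCharDet A B a b)) := by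
  have hcont := continuous_delayCharDet A B
  generalize delayCharDet A B = F at hcont ⊢
  exact (hcont.tendsto (a, b)).comp (hu.prodMk_nhds hv)

variable {A B} in
theorem Differentiable.delayCharDet {u v : ℂ → ℂ} (hu : Differentiable ℂ u)
    (hv : Differentiable ℂ v) : Differentiable ℂ fun s => delayCharDet A B (u s) (v s) := by
  unfold _root_.delayCharDet
  simp only [Matrix.det_apply]
  refine Differentiable.fun_sum fun σ _ => Differentiable.const_smul ?_ _
  refine Differentiable.fun_finsetProd fun i _ => ?_
  simp only [Matrix.sub_apply, Matrix.add_apply, Matrix.smul_apply, smul_eq_mul]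
  fun_prop

theorem delayCharDet_eq_zero_iff_mem_spectrum {s z : ℂ} :
    delayCharDet A B s z = 0 ↔ s ∈ spectrum ℂ (A + z • B) := by
  rw [spectrum.mem_iff, Matrix.isUnit_iff_isUnit_det, isUnit_iff_ne_zero, not_not,
    Algebra.algebraMap_eq_smul_one, delayCharDet]

variable {A B}

/-- If `det (s I - A - e^{-sh} B)` has no zero in the closed right half-plane for any delay
`h ≥ 0`, then `A` has no eigenvalue in the open right half-plane. -/
theorem delayCharDet_zero_ne_zero_of_re_pos
    (hAB : ∀ h : ℝ, 0 ≤ h → ∀ s : ℂ, 0 ≤ s.re → delayCharDet A B s (Complex.exp (-(s * h))) ≠ 0)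
    {s₀ : ℂ} (hs₀ : 0 < s₀.re) : delayCharDet A B s₀ 0 ≠ 0 := by
  intro hzero
  have hlim : ∀ z : ℂ, 0 < z.re →
      Tendsto (fun q : ℝ × ℂ => delayCharDet A B q.2 (Complex.exp (-(q.2 * q.1))))
        (atTop ×ˢ nhds z) (nhds (delayCharDet A B z 0)) := by
    intro z hz
    have hexp : Tendsto (fun q : ℝ × ℂ => Complex.exp (-(q.2 * q.1))) (atTop ×ˢ nhds z)
        (nhds 0) := by
      rw [Complex.tendsto_exp_nhds_zero_iff]
      have hre : Tendsto (fun q : ℝ × ℂ => q.2.re) (atTop ×ˢ nhds z) (nhds z.re) :=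
        (Complex.continuous_re.tendsto z).comp tendsto_snd
      have := hre.pos_mul_atTop hz (tendsto_fst (f := (atTop : Filter ℝ)) (g := nhds z))
      simpa using this
    exact tendsto_delayCharDet tendsto_snd hexp
  have hev := eventually_exists_zero_mem_ball (l := (atTop : Filter ℝ))
    (f := fun h s => delayCharDet A B s (Complex.exp (-(s * h))))
    (f₀ := fun s => delayCharDet A B s 0) (z₀ := s₀)
    (fun h => Differentiable.delayCharDet (by fun_prop) (by fun_prop))
    (Differentiable.delayCharDet (by fun_prop) (by fun_prop)) hzero
    (by
      obtain ⟨w, hw⟩ := (Matrix.finite_spectrum (A + (0 : ℂ) • B)).exists_notMem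
      exact ⟨w, fun h => hw ((delayCharDet_eq_zero_iff_mem_spectrum A B).1 h)⟩)
    (by
      filter_upwards [(isOpen_lt continuous_const Complex.continuous_re).mem_nhds hs₀] with z hz
      exact hlim z hz)
    hs₀
  obtain ⟨h, ⟨s, hs, hs0⟩, hh⟩ := (hev.and (eventually_ge_atTop 0)).exists
  refine hAB h hh s ?_ hs0
  have := (Complex.abs_re_le_norm (s - s₀)).trans_lt (mem_ball_iff_norm.1 hs)
  rw [Complex.sub_re] at this
  linarith [(abs_lt.1 this).1]

/-- At a nonzero point `iy` of the imaginary axis, a zero of `z ↦ det (iy I - A - z B)` in the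
punctured open unit disc produces, for some large delay, a zero of `det (s I - A - e^{-sh} B)` in
the open right half-plane. -/
theorem delayCharDet_ne_zero_of_norm_lt_one
    (hAB : ∀ h : ℝ, 0 ≤ h → ∀ s : ℂ, 0 ≤ s.re → delayCharDet A B s (Complex.exp (-(s * h))) ≠ 0)
    {y : ℝ} (hy : y ≠ 0) {z : ℂ} (hz0 : z ≠ 0) (hz1 : ‖z‖ < 1) :
    delayCharDet A B (y * Complex.I) z ≠ 0 := by
  intro hzero
  set σ₀ : ℂ := -Complex.log z with hσ₀
  have hσ₀re : 0 < σ₀.re := by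
    rw [hσ₀, Complex.neg_re, Complex.log_re]
    linarith [Real.log_neg (norm_pos_iff.2 hz0) hz1]
  have hev := eventually_exists_zero_mem_ball (l := nhds (0 : ℝ))
    (f := fun ε σ => delayCharDet A B (y * Complex.I + ε * σ) (Complex.exp (-σ)))
    (f₀ := fun σ => delayCharDet A B (y * Complex.I) (Complex.exp (-σ))) (z₀ := σ₀)
    (fun h => Differentiable.delayCharDet (by fun_prop) (by fun_prop))
    (Differentiable.delayCharDet (by fun_prop) (by fun_prop))
    (by simpa [hσ₀, Complex.exp_log hz0] using hzero)
    ⟨0, by simpa using hAB 0 le_rfl (y * Complex.I) (by simp)⟩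
    (Eventually.of_forall fun σ => by
      rw [← nhds_prod_eq]
      have hcont : Continuous fun q : ℝ × ℂ =>
          delayCharDet A B (y * Complex.I + q.1 * q.2) (Complex.exp (-q.2)) :=
        (continuous_delayCharDet A B).comp (by fun_prop :
          Continuous fun q : ℝ × ℂ => ((y * Complex.I + q.1 * q.2 : ℂ), Complex.exp (-q.2)))
      simpa using hcont.tendsto (0, σ))
    hσ₀re
  have hseq : Tendsto (fun k : ℕ => |y| / (2 * Real.pi) * (1 / ((k : ℝ) + 1))) atTop (nhds 0) := by
    simpa using tendsto_one_div_add_atTop_nhds_zero_nat.const_mul (|y| / (2 * Real.pi))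
  obtain ⟨k, σ, hσ, hσ0⟩ := (hseq.eventually hev).exists
  set ε : ℝ := |y| / (2 * Real.pi) * (1 / ((k : ℝ) + 1)) with hε
  have hk : (0 : ℝ) < k + 1 := by positivity
  have hy' : 0 < |y| := abs_pos.2 hy
  have hε0 : 0 < ε := by positivity
  have hσre : 0 < σ.re := by
    have := (Complex.abs_re_le_norm (σ - σ₀)).trans_lt (mem_ball_iff_norm.1 hσ)
    rw [Complex.sub_re] at this
    linarith [(abs_lt.1 this).1]
  refine hAB ε⁻¹ (by positivity) (y * Complex.I + ε * σ) ?_ ?_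
  · simp only [Complex.add_re, Complex.mul_re, Complex.ofReal_re, Complex.I_re, mul_zero,
      Complex.ofReal_im, Complex.I_im, mul_one, sub_self, zero_add, zero_mul, sub_zero]
    positivity
  · have hperiod : ∃ m : ℤ, y * ε⁻¹ = m * (2 * Real.pi) := by
      have hinv : ε⁻¹ = (2 * Real.pi) * (k + 1) / |y| := by
        rw [hε]; field_simp
      rcases abs_choice y with h | h
      · refine ⟨k + 1, ?_⟩
        rw [hinv, h]; push_cast; field_simp
      · refine ⟨-(k + 1), ?_⟩
        rw [hinv, h]; push_cast; field_simp
    obtain ⟨m, hm⟩ := hperiod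
    have hm' : (y : ℂ) * (ε : ℂ)⁻¹ = m * (2 * Real.pi) := by exact_mod_cast hm
    have hεC : (ε : ℂ) ≠ 0 := by exact_mod_cast hε0.ne'
    have harg : -((y * Complex.I + ε * σ) * ((ε⁻¹ : ℝ) : ℂ))
        = -σ + (-m : ℤ) * (2 * Real.pi * Complex.I) := by
      push_cast
      have h1 : (ε : ℂ) * σ * (ε : ℂ)⁻¹ = σ := by field_simp
      linear_combination (-Complex.I) * hm' - h1
    rw [harg, Complex.exp_add, Complex.exp_int_mul_two_pi_mul_I, mul_one]
    exact hσ0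

/-- If `det (s I - A - e^{-sh} B)` has no zero in the closed right half-plane for any delay
`h ≥ 0`, then `A` has no eigenvalue in the closed right half-plane. -/
theorem delayCharDet_zero_ne_zero
    (hAB : ∀ h : ℝ, 0 ≤ h → ∀ s : ℂ, 0 ≤ s.re → delayCharDet A B s (Complex.exp (-(s * h))) ≠ 0)
    {s₀ : ℂ} (hs₀ : 0 ≤ s₀.re) : delayCharDet A B s₀ 0 ≠ 0 := by
  rcases hs₀.lt_or_eq with hpos | hre
  · exact delayCharDet_zero_ne_zero_of_re_pos hAB hpos
  intro hzero
  obtain ⟨ω, rfl⟩ : ∃ ω : ℝ, s₀ = ω * Complex.I :=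
    ⟨s₀.im, Complex.ext (by simp [← hre]) (by simp)⟩
  have hcont : Continuous fun q : ℝ × ℂ => delayCharDet A B (q.1 * Complex.I) q.2 :=
    (continuous_delayCharDet A B).comp (by fun_prop :
      Continuous fun q : ℝ × ℂ => ((q.1 * Complex.I : ℂ), q.2))
  have hev := eventually_exists_zero_mem_ball (l := nhds ω)
    (f := fun y z => delayCharDet A B (y * Complex.I) z)
    (f₀ := fun z => delayCharDet A B (ω * Complex.I) z) (z₀ := 0)
    (fun h => Differentiable.delayCharDet (by fun_prop) (by fun_prop))
    (Differentiable.delayCharDet (by fun_prop) (by fun_prop)) hzero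
    ⟨1, by simpa using hAB 0 le_rfl (ω * Complex.I) (by simp)⟩
    (Eventually.of_forall fun z => by
      rw [← nhds_prod_eq]
      exact hcont.tendsto (ω, z))
    one_pos
  have hfin : Set.Finite {y : ℝ | delayCharDet A B (y * Complex.I) 0 = 0} := by
    have hinj : Function.Injective fun y : ℝ => (y : ℂ) * Complex.I := fun a b hab => by
      simpa using hab
    refine ((Matrix.finite_spectrum (A + (0 : ℂ) • B)).preimage hinj.injOn).subset fun y hy => ?_
    exact (delayCharDet_eq_zero_iff_mem_spectrum A B).1 hy
  have hgood : ∀ᶠ y : ℝ in nhdsWithin ω {ω}ᶜ,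
      y ≠ 0 ∧ delayCharDet A B (y * Complex.I) 0 ≠ 0 := by
    have hbad : (({0} : Set ℝ) ∪ {y : ℝ | delayCharDet A B (y * Complex.I) 0 = 0}).Finite :=
      (Set.finite_singleton 0).union hfin
    have hclosed : IsClosed ((({0} : Set ℝ) ∪ {y : ℝ | delayCharDet A B (y * Complex.I) 0 = 0}) \ {ω}) :=
      hbad.sdiff.isClosed
    have hmem : ((({0} : Set ℝ) ∪ {y : ℝ | delayCharDet A B (y * Complex.I) 0 = 0}) \ {ω})ᶜ ∈ nhds ω :=
      hclosed.isOpen_compl.mem_nhds (by simp)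
    filter_upwards [mem_nhdsWithin_of_mem_nhds hmem, self_mem_nhdsWithin] with y hy hyω
    simp only [Set.mem_compl_iff, Set.mem_sdiff, Set.mem_union, Set.mem_singleton_iff,
      Set.mem_ofPred_eq] at hy hyω
    tauto
  obtain ⟨y, ⟨z, hz, hz0⟩, hy, hyA⟩ :=
    ((hev.filter_mono nhdsWithin_le_nhds).and hgood).exists
  refine delayCharDet_ne_zero_of_norm_lt_one hAB hy (fun h => hyA (by rwa [h] at hz0)) ?_ hz0
  simpa using hz

end delayCharDet

/-- The real part of the exponential mode `e^{st} v` solves the delayed system with all delays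
equal to `h` when `(A₀ + e^{-sh} ∑ᵢ Aᵢ) v = s v`. -/
theorem hasDerivAt_re_exp_mode {n r : ℕ} (A0 : Fin (r + 1) → Matrix (Fin n) (Fin n) ℝ) (h : ℝ)
    {s : ℂ} {v : Fin n → ℂ}
    (hv : ((A0 0).map (Complex.ofReal ·) + Complex.exp (-(s * h)) •
      ∑ i : Fin r, (A0 i.succ).map (Complex.ofReal ·)) *ᵥ v = s • v) (t : ℝ) :
    HasDerivAt (fun (t : ℝ) j => (Complex.exp (s * t) * v j).re)
      (∑ i, (A0 i).mulVec
        (fun j => (Complex.exp (s * ↑(t - if i = 0 then 0 else h)) * v j).re)) t := by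
  refine hasDerivAt_pi.2 fun j => ?_
  have hre (M : Matrix (Fin n) (Fin n) ℝ) (c : ℂ) :
      M.mulVec (fun k => (c * v k).re) j = (c * (M.map (Complex.ofReal ·) *ᵥ v) j).re := by
    simp only [Matrix.mulVec, dotProduct, Finset.mul_sum, Complex.re_sum, Matrix.map_apply]
    refine Finset.sum_congr rfl fun k _ => ?_
    rw [mul_left_comm, Complex.re_ofReal_mul]
  have hd : HasDerivAt (fun t : ℝ => Complex.exp (s * t) * v j)
      (Complex.exp (s * t) * s * v j) t := by
    have h1 : HasDerivAt (fun t : ℝ => s * (t : ℂ)) s t := by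
      simpa using (Complex.ofRealCLM.hasDerivAt (x := t)).const_mul s
    exact h1.cexp.mul_const _
  have hd' := Complex.reCLM.hasFDerivAt.comp_hasDerivAt t hd
  refine hd'.congr_deriv ?_
  symm
  rw [Finset.sum_apply, Fin.sum_univ_succ]
  simp only [hre, Fin.succ_ne_zero, if_true, if_false, sub_zero, Complex.reCLM_apply]
  have hvj := congrFun hv j
  simp only [Matrix.add_mulVec, Matrix.smul_mulVec, Matrix.sum_mulVec, Pi.add_apply,
    Pi.smul_apply, Finset.sum_apply, smul_eq_mul] at hvj
  rw [← Complex.re_sum, ← Complex.add_re, mul_assoc, ← hvj, ← Finset.mul_sum]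
  congr 1
  have hexp : Complex.exp (s * ((t - h : ℝ) : ℂ))
      = Complex.exp (s * t) * Complex.exp (-(s * h)) := by
    rw [← Complex.exp_add]; congr 1; push_cast; ring
  rw [hexp]
  ring

/-- Stability independent of the delays excludes characteristic roots in the closed right
half-plane, for all delays equal. -/
theorem delayCharDet_exp_ne_zero {n r : ℕ} {A0 : Fin (r + 1) → Matrix (Fin n) (Fin n) ℝ}
    (hstab : ∀ hdel : Fin (r + 1) → ℝ, hdel 0 = 0 → (∀ i, 0 ≤ hdel i) →
      ∀ x : ℝ → Fin n → ℝ,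
        ContinuousOn x (Set.Ici (-(⨆ i, hdel i))) →
        (∀ t > (0 : ℝ), HasDerivAt x (∑ i, (A0 i).mulVec (x (t - hdel i))) t) →
        Tendsto x atTop (nhds 0))
    {h : ℝ} (hh : 0 ≤ h) {s : ℂ} (hs : 0 ≤ s.re) :
    delayCharDet ((A0 0).map (Complex.ofReal ·)) (∑ i : Fin r, (A0 i.succ).map (Complex.ofReal ·))
      s (Complex.exp (-(s * h))) ≠ 0 := by
  intro hdet
  obtain ⟨v, hv0, hv⟩ := Matrix.exists_mulVec_eq_zero_iff.2 hdet
  rw [Matrix.sub_mulVec, Matrix.smul_mulVec, Matrix.one_mulVec, sub_eq_zero] at hv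
  have hlim : ∀ c : ℂ, ∀ j,
      Tendsto (fun t : ℝ => (Complex.exp (s * t) * (c * v j)).re) atTop (nhds 0) := by
    intro c j
    have hcv := hasDerivAt_re_exp_mode A0 h (s := s) (v := c • v)
      (by rw [Matrix.mulVec_smul, ← hv, smul_comm])
    have := hstab (fun i => if i = 0 then 0 else h) (by simp)
      (fun i => by split_ifs <;> simp [hh]) _
      (fun t _ => (hcv t).continuousAt.continuousWithinAt) (fun t _ => hcv t)
    simpa using tendsto_pi_nhds.1 this j
  obtain ⟨j, hj⟩ := Function.ne_iff.1 hv0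
  have hre : Tendsto (fun t : ℝ => (Complex.exp (s * t) * v j).re) atTop (nhds 0) := by
    simpa using hlim 1 j
  have him : Tendsto (fun t : ℝ => (Complex.exp (s * t) * v j).im) atTop (nhds 0) := by
    refine (hlim (-Complex.I) j).congr fun t => ?_
    rw [mul_left_comm]
    simp
  have hsum : Tendsto (fun t : ℝ => |(Complex.exp (s * t) * v j).re|
      + |(Complex.exp (s * t) * v j).im|) atTop (nhds 0) := by
    simpa using hre.abs.add him.abs
  have hle : ‖v j‖ ≤ 0 := by
    refine ge_of_tendsto hsum ?_
    filter_upwards [eventually_ge_atTop 0] with t ht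
    refine le_trans ?_ (Complex.norm_le_abs_re_add_abs_im _)
    rw [norm_mul, Complex.norm_exp]
    refine le_mul_of_one_le_left (norm_nonneg _) (Real.one_le_exp ?_)
    simpa using mul_nonneg hs ht
  exact hj (norm_le_zero_iff.1 hle)


/-- **Necessity of Hurwitz matrices for stability independent of the delays.**
If for every choice of delays every solution of `ẋ(t) = ∑ᵢ A₀ᵢ x(t−hᵢ)` is bounded and tends
to zero, then both `A₀₀` and `∑ᵢ A₀ᵢ` are stability matrices. -/
theorem necessity_of_hurwitz (n r : ℕ) (hn : 1 ≤ n) (hr : 1 ≤ r)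
    (A0 : Fin (r + 1) → Matrix (Fin n) (Fin n) ℝ)
    (hstab : ∀ hdel : Fin (r + 1) → ℝ, hdel 0 = 0 → (∀ i, 0 ≤ hdel i) →
      ∀ x : ℝ → Fin n → ℝ,
        ContinuousOn x (Set.Ici (-(⨆ i, hdel i))) →
        (∀ t > (0 : ℝ), HasDerivAt x (∑ i, (A0 i).mulVec (x (t - hdel i))) t) →
        (∃ C : ℝ, ∀ t ≥ -(⨆ i, hdel i), ‖x t‖ ≤ C) ∧ Tendsto x atTop (nhds 0)) :
    (∀ μ ∈ spectrum ℂ ((A0 0).map (Complex.ofReal ·)), μ.re < 0) ∧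
      ∀ μ ∈ spectrum ℂ ((∑ i, A0 i).map (Complex.ofReal ·)), μ.re < 0 := by
  have hAB : ∀ h : ℝ, 0 ≤ h → ∀ s : ℂ, 0 ≤ s.re →
      delayCharDet ((A0 0).map (Complex.ofReal ·))
        (∑ i : Fin r, (A0 i.succ).map (Complex.ofReal ·)) s (Complex.exp (-(s * h))) ≠ 0 :=
    fun h hh s hs => delayCharDet_exp_ne_zero
      (fun hdel h0 hnn x hc hx => (hstab hdel h0 hnn x hc hx).2) hh hs
  have hsum : (∑ i, A0 i).map (Complex.ofReal ·) = (A0 0).map (Complex.ofReal ·) +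
      (1 : ℂ) • ∑ i : Fin r, (A0 i.succ).map (Complex.ofReal ·) := by
    ext a b
    simp [Matrix.sum_apply, Fin.sum_univ_succ]
  refine ⟨fun μ hμ => ?_, fun μ hμ => ?_⟩
  · by_contra! hre
    exact delayCharDet_zero_ne_zero hAB hre
      ((delayCharDet_eq_zero_iff_mem_spectrum _ _).2 (by simpa using hμ))
  · by_contra! hre
    rw [hsum] at hμ
    refine hAB 0 le_rfl μ hre ((delayCharDet_eq_zero_iff_mem_spectrum _ _).2 ?_)
    simpa using hμ
end
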